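/- Let M be a compact metrizable topological manifold (without boundary), equipped with a metric ρ. Then there exists ε > 0 such that every homeomorphism h : M → M with sup_{x ∈ M} ρ(h(x), x) < ε is isotopic to the identity: there exists a continuous H : M × [0,1] → M with H(·, 0) = h, H(·, 1) = 1_M, and such that H(·, t) is a homeomorphism of M for every t ∈ [0,1]. -/

import Mathlib

open unitInterval

/-- A space is locally Euclidean (a manifold without boundary): every point has an open
neighbourhood homeomorphic to an open subset of some Euclidean space `ℝ^n`. -/
def LocallyEuclidean (M : Type*) [TopologicalSpace M] : Prop :=
  ∀ x : M, ∃ (n : ℕ) (U : Set M) (V : Set (EuclideanSpace ℝ (Fin n))),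
    IsOpen U ∧ x ∈ U ∧ IsOpen V ∧ Nonempty (↥U ≃ₜ ↥V)

namespace HomeoIsotopy

open Set Metric Filter Topology

section LocalHomeomorph

variable {X Y : Type*} [TopologicalSpace X] [TopologicalSpace Y]

lemma isLocalHomeomorphOn_of_locally_eqOn {f : X → Y} {s : Set X}
    (h : ∀ x ∈ s, ∃ (g : X → Y) (u : Set X), IsOpen u ∧ x ∈ u ∧ IsLocalHomeomorphOn g u ∧
      EqOn f g u) : IsLocalHomeomorphOn f s := by
  refine IsLocalHomeomorphOn.mk f s fun x hx => ?_
  obtain ⟨g, u, hu, hxu, hg, hfg⟩ := h x hx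
  obtain ⟨e, hxe, rfl⟩ := hg x hxu
  refine ⟨e.restrOpen u hu, ⟨hxe, hxu⟩, fun y hy => ?_⟩
  exact hfg hy.2

lemma exists_openPartialHomeomorph [Nonempty X] {f : X → Y} {s : Set X} (hs : IsOpen s)
    (hf : IsLocalHomeomorphOn f s) (hinj : InjOn f s) :
    ∃ e : OpenPartialHomeomorph X Y, e.source = s ∧ ⇑e = f := by
  refine ⟨OpenPartialHomeomorph.ofContinuousOpenRestrict hinj.toPartialEquiv hf.continuousOn ?_ hs,
    rfl, rfl⟩
  refine IsOpenMap.of_nhds_le ?_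
  rintro ⟨x, hx⟩
  have h1 : map (Subtype.val : s → X) (𝓝 ⟨x, hx⟩) = 𝓝 x :=
    hs.isOpenEmbedding_subtypeVal.map_nhds_eq ⟨x, hx⟩
  change 𝓝 (f x) ≤ map (f ∘ Subtype.val) (𝓝 (⟨x, hx⟩ : s))
  rw [← Filter.map_map, h1, hf.map_nhds_eq hx]

end LocalHomeomorph

section NearEmbedding

/-- A piecewise linear homeomorphism of the line, the identity on `[3, ∞)` and the translation
by `-8` on `(-∞, 2]`. -/
noncomputable def expandLine : ℝ ≃ₜ ℝ where
  toFun t := t - 8 + 8 * max 0 (min 1 (t - 2))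
  invFun u := u + 8 - 8 * max 0 (min 1 ((u + 6) / 9))
  left_inv t := by
    simp only [max_def, min_def]; split_ifs <;> linarith
  right_inv u := by
    simp only [max_def, min_def]; split_ifs <;> linarith
  continuous_toFun := by fun_prop
  continuous_invFun := by fun_prop

/-- A piecewise linear homeomorphism of the line, the translation by `-5` on `[4, ∞)` and the
identity on `(-∞, -6]`. -/
noncomputable def compressLine : ℝ ≃ₜ ℝ where
  toFun t := t - 5 * max 0 (min 1 ((t + 6) / 10))
  invFun u := u + 5 * max 0 (min 1 ((u + 6) / 5))
  left_inv t := by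
    simp only [max_def, min_def]; split_ifs <;> linarith
  right_inv u := by
    simp only [max_def, min_def]; split_ifs <;> linarith
  continuous_toFun := by fun_prop
  continuous_invFun := by fun_prop

lemma expandLine_apply (t : ℝ) : expandLine t = t - 8 + 8 * max 0 (min 1 (t - 2)) := rfl

lemma expandLine_symm_apply (u : ℝ) :
    expandLine.symm u = u + 8 - 8 * max 0 (min 1 ((u + 6) / 9)) := rfl

lemma compressLine_apply (t : ℝ) : compressLine t = t - 5 * max 0 (min 1 ((t + 6) / 10)) := rfl

lemma compressLine_symm_apply (u : ℝ) :
    compressLine.symm u = u + 5 * max 0 (min 1 ((u + 6) / 5)) := rfl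

lemma abs_expandLine_sub_le (s t : ℝ) : |expandLine s - expandLine t| ≤ 9 * |s - t| := by
  simp only [expandLine_apply, max_def, min_def]
  rcases abs_cases (s - t) with h | h <;> rw [abs_le] <;> constructor <;> split_ifs <;> linarith

lemma abs_compressLine_sub_le (s t : ℝ) : |compressLine s - compressLine t| ≤ |s - t| := by
  simp only [compressLine_apply, max_def, min_def]
  rcases abs_cases (s - t) with h | h <;> rw [abs_le] <;> constructor <;> split_ifs <;> linarith

variable {ι : Type*}

/-- The homeomorphism of `ι → ℝ` acting by `s` on the coordinate `i`. -/
def coordHomeo [DecidableEq ι] (i : ι) (s : ℝ ≃ₜ ℝ) : (ι → ℝ) ≃ₜ (ι → ℝ) :=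
  Homeomorph.piCongrRight fun j => if j = i then s else Homeomorph.refl ℝ

lemma coordHomeo_apply [DecidableEq ι] (i : ι) (s : ℝ ≃ₜ ℝ) (x : ι → ℝ) (j : ι) :
    coordHomeo i s x j = if j = i then s (x j) else x j := by
  by_cases h : j = i <;> simp [coordHomeo, h]

lemma coordHomeo_symm [DecidableEq ι] (i : ι) (s : ℝ ≃ₜ ℝ) :
    (coordHomeo i s).symm = coordHomeo i s.symm := by
  ext x j
  by_cases h : j = i <;> simp [coordHomeo, h]

lemma norm_coordHomeo_sub_le [DecidableEq ι] [Fintype ι] (i : ι) {s : ℝ ≃ₜ ℝ} {c : ℝ} (hc : 1 ≤ c)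
    (hs : ∀ a b, |s a - s b| ≤ c * |a - b|) (x y : ι → ℝ) :
    ‖coordHomeo i s x - coordHomeo i s y‖ ≤ c * ‖x - y‖ := by
  refine (pi_norm_le_iff_of_nonneg (by positivity)).2 fun j => ?_
  have hj : |x j - y j| ≤ ‖x - y‖ := norm_le_pi_norm (x - y) j
  rw [Pi.sub_apply, coordHomeo_apply, coordHomeo_apply, Real.norm_eq_abs]
  split_ifs
  · exact (hs _ _).trans (by gcongr)
  · nlinarith [norm_nonneg (x - y)]

/-- The points of `ι → ℝ` whose coordinates in `J` have absolute value less than `r`. -/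
def slab (J : Finset ι) (r : ℝ) : Set (ι → ℝ) := {x | ∀ j ∈ J, |x j| < r}

lemma isOpen_slab (J : Finset ι) (r : ℝ) : IsOpen (slab J r) := by
  have : slab J r = ⋂ j ∈ J, {x : ι → ℝ | |x j| < r} := by ext; simp [slab]
  rw [this]
  exact isOpen_biInter_finset fun j _ => isOpen_lt (by fun_prop) continuous_const

lemma convex_slab (J : Finset ι) (r : ℝ) : Convex ℝ (slab J r) := by
  have : slab J r = ⋂ j ∈ J, (LinearMap.proj (R := ℝ) (φ := fun _ : ι => ℝ) j) ⁻¹' ball 0 r := by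
    ext; simp [slab]
  rw [this]
  exact convex_iInter₂ fun j _ => (convex_ball _ _).linear_preimage _

variable [Fintype ι]

lemma abs_apply_sub_le {x y : ι → ℝ} {c : ℝ} (h : ‖x - y‖ ≤ c) (j : ι) : |x j - y j| ≤ c :=
  (norm_le_pi_norm (x - y) j).trans h

lemma mem_slab_of_norm_sub_le {J : Finset ι} {r c s : ℝ} {x y : ι → ℝ} (hy : y ∈ slab J r)
    (h : ‖x - y‖ ≤ c) (hs : r + c ≤ s) : x ∈ slab J s := fun j hj => by
  have h1 := abs_apply_sub_le h j
  have h2 := hy j hj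
  have h3 : |x j| ≤ |x j - y j| + |y j| := by simpa using abs_add_le (x j - y j) (y j)
  linarith

/-- `f` is an open embedding of `s` that moves points by at most `ε`. -/
structure IsNearEmbedding (f : (ι → ℝ) → (ι → ℝ)) (s : Set (ι → ℝ)) (ε : ℝ) : Prop where
  isLocalHomeomorphOn : IsLocalHomeomorphOn f s
  injOn : InjOn f s
  norm_sub_le : ∀ x ∈ s, ‖f x - x‖ ≤ ε

lemma IsNearEmbedding.subset_image {f : (ι → ℝ) → (ι → ℝ)} {s U : Set (ι → ℝ)} {ε : ℝ}
    (hf : IsNearEmbedding f s ε) (hs : IsOpen s) (hU : IsPreconnected U)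
    (hsub : ∀ y ∈ U, closedBall y ε ⊆ s) {x₀ : ι → ℝ} (hx₀ : x₀ ∈ s) (hfx₀ : f x₀ ∈ U) :
    U ⊆ f '' s := by
  have hopen : IsOpen (f '' s) := by
    rw [isOpen_iff_mem_nhds]
    rintro _ ⟨x, hx, rfl⟩
    rw [← hf.isLocalHomeomorphOn.map_nhds_eq hx]
    exact image_mem_map (hs.mem_nhds hx)
  refine hU.subset_of_closure_inter_subset hopen ⟨f x₀, hfx₀, x₀, hx₀, rfl⟩ ?_
  rintro y ⟨hy, hyU⟩
  obtain ⟨u, hu, hlim⟩ := mem_closure_iff_seq_limit.1 hy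
  choose x hxs hxu using hu
  obtain ⟨R, hR⟩ := hlim.norm.bddAbove_range
  have hbd : ∀ n, x n ∈ closedBall (0 : ι → ℝ) (R + ε) := fun n => by
    have h1 : ‖f (x n) - x n‖ ≤ ε := hf.norm_sub_le _ (hxs n)
    have h2 : ‖f (x n)‖ ≤ R := by rw [hxu]; exact hR ⟨n, rfl⟩
    have h3 : ‖x n‖ ≤ ‖f (x n)‖ + ‖f (x n) - x n‖ := by
      simpa using _root_.norm_sub_le (f (x n)) (f (x n) - x n)
    rw [mem_closedBall_zero_iff]; linarith
  obtain ⟨z, -, φ, hφ, hz⟩ := (isCompact_closedBall (0 : ι → ℝ) (R + ε)).tendsto_subseq hbd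
  have hlim' : Tendsto (fun n => u (φ n)) atTop (𝓝 y) := hlim.comp hφ.tendsto_atTop
  have hzy : ‖y - z‖ ≤ ε := by
    refine le_of_tendsto (hlim'.sub hz).norm (Eventually.of_forall fun n => ?_)
    simp only [Function.comp_apply, ← hxu]
    exact hf.norm_sub_le _ (hxs _)
  have hzs : z ∈ s := hsub y hyU (by rwa [mem_closedBall, dist_comm, dist_eq_norm])
  refine ⟨z, hzs, tendsto_nhds_unique ?_ hlim'⟩
  simp only [← hxu]
  exact ((hf.isLocalHomeomorphOn.continuousAt hzs).tendsto.comp hz)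

end NearEmbedding

section Interpolation

variable {ι : Type*} [Fintype ι]

lemma exists_interpolate_translate [DecidableEq ι] {J : Finset ι} {i : ι} {r : ℝ}
    (hr : 20 ≤ r) {ε : ℝ} (hε : ε ≤ 1 / 1000) {f : (ι → ℝ) → (ι → ℝ)}
    (hf : IsNearEmbedding f (slab (insert i J) (r + 1)) ε) :
    ∃ Φ : (ι → ℝ) → (ι → ℝ),
      IsNearEmbedding Φ {x | x ∈ slab J r ∧ -10 < x i ∧ x i < 2} (11 * ε) ∧
      (∀ x ∈ slab J r, -1 ≤ x i → x i < 2 → Φ x = f x) ∧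
      (∀ x ∈ slab J r, -10 < x i → x i ≤ -7 → Φ x = f (x + Pi.single i 8) - Pi.single i 8) ∧
      ∀ Z : Set (ι → ℝ), (∀ x ∈ Z, ∀ y, (∀ j, j ≠ i → y j = x j) → y ∈ Z) →
        (∀ x ∈ Z ∩ slab (insert i J) (r + 1), f x = x) →
        ∀ x ∈ Z ∩ slab J r, -10 < x i → x i < 2 → Φ x = x := by
  set Ω : Set (ι → ℝ) := slab (insert i J) (r + 1) with hΩ
  have hΩo : IsOpen Ω := isOpen_slab _ _
  have h0 : (0 : ι → ℝ) ∈ Ω := fun j _ => by simp; linarith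
  have hε0 : 0 ≤ ε := (norm_nonneg _).trans (hf.norm_sub_le 0 h0)
  have himg : slab (insert i J) (r + 1 / 2) ⊆ f '' Ω := by
    refine hf.subset_image hΩo (convex_slab _ _).isPreconnected ?_ h0 ?_
    · intro y hy x hx
      rw [mem_closedBall, dist_eq_norm] at hx
      exact mem_slab_of_norm_sub_le hy hx (by linarith)
    · refine mem_slab_of_norm_sub_le (y := 0) (r := 1) (fun j _ => by simp)
        (hf.norm_sub_le 0 h0) (by linarith)
  obtain ⟨e, hes, hef⟩ := exists_openPartialHomeomorph hΩo hf.isLocalHomeomorphOn hf.injOn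
  have het : e.target = f '' Ω := by rw [← e.image_source_eq_target, hes, hef]
  set T := coordHomeo i expandLine with hT
  set S := coordHomeo i compressLine with hS
  have hTi : ∀ x, T x i = expandLine (x i) := fun x => by simp [hT, coordHomeo_apply]
  have hSi : ∀ x, S x i = compressLine (x i) := fun x => by simp [hS, coordHomeo_apply]
  have hTj : ∀ x j, j ≠ i → T x j = x j := fun x j h => by simp [hT, coordHomeo_apply, h]
  have hSj : ∀ x j, j ≠ i → S x j = x j := fun x j h => by simp [hS, coordHomeo_apply, h]
  have hTi' : ∀ x, T.symm x i = expandLine.symm (x i) := fun x => by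
    rw [hT, coordHomeo_symm]; simp [coordHomeo_apply]
  have hSi' : ∀ x, S.symm x i = compressLine.symm (x i) := fun x => by
    rw [hS, coordHomeo_symm]; simp [coordHomeo_apply]
  have hTj' : ∀ x j, j ≠ i → T.symm x j = x j := fun x j h => by
    rw [hT, coordHomeo_symm]; simp [coordHomeo_apply, h]
  have hSj' : ∀ x j, j ≠ i → S.symm x j = x j := fun x j h => by
    rw [hS, coordHomeo_symm]; simp [coordHomeo_apply, h]
  set D : Set (ι → ℝ) := {x | x ∈ slab J r ∧ -10 < x i ∧ x i < 2} with hD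
  have hm12 : ∀ x ∈ D, T.symm (S.symm x) ∈ Ω := by
    rintro x ⟨hxJ, h1, h2⟩ j hj
    by_cases hji : j = i
    · subst hji
      rw [hTi', hSi', expandLine_symm_apply, compressLine_symm_apply, abs_lt]
      simp only [max_def, min_def]
      constructor <;> split_ifs <;> linarith
    · rw [hTj' _ _ hji, hSj' _ _ hji]
      linarith [hxJ j ((Finset.mem_insert.1 hj).resolve_left hji)]
  have hd4 : ∀ x ∈ D, ‖T (f (T.symm (S.symm x))) - S.symm x‖ ≤ 9 * ε := fun x hx => by
    have h1 := norm_coordHomeo_sub_le i (by norm_num) abs_expandLine_sub_le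
      (f (T.symm (S.symm x))) (T.symm (S.symm x))
    rw [← hT, T.apply_symm_apply] at h1
    exact h1.trans (by linarith [hf.norm_sub_le _ (hm12 x hx)])
  have hm4 : ∀ x ∈ D, T (f (T.symm (S.symm x))) ∈ e.target := by
    intro x hx
    rw [het]
    refine himg (mem_slab_of_norm_sub_le (y := S.symm x) (r := r) ?_ (hd4 x hx) (by linarith))
    obtain ⟨hxJ, h1, h2⟩ := hx
    intro j hj
    by_cases hji : j = i
    · subst hji
      rw [hSi', compressLine_symm_apply, abs_lt]
      simp only [max_def, min_def]
      constructor <;> split_ifs <;> linarith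
    · rw [hSj' _ _ hji]
      exact hxJ j ((Finset.mem_insert.1 hj).resolve_left hji)
  have hes_mem : ∀ y ∈ e.target, e.symm y ∈ Ω := fun y hy => hes ▸ e.map_target hy
  have hfe : ∀ y ∈ e.target, f (e.symm y) = y := fun y hy => by
    have := e.right_inv hy
    rwa [hef] at this
  have hef' : ∀ x ∈ Ω, e.symm (f x) = x := fun x hx => by
    have := e.left_inv (hes ▸ hx)
    rwa [hef] at this
  have hde : ∀ y ∈ e.target, ‖e.symm y - y‖ ≤ ε := fun y hy => by
    have := hf.norm_sub_le _ (hes_mem y hy)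
    rwa [hfe y hy, norm_sub_rev] at this
  have hd5 : ∀ x ∈ D, ‖e.symm (T (f (T.symm (S.symm x)))) - S.symm x‖ ≤ 10 * ε := fun x hx => by
    have h1 := norm_sub_le_norm_sub_add_norm_sub (e.symm (T (f (T.symm (S.symm x)))))
      (T (f (T.symm (S.symm x)))) (S.symm x)
    linarith [hd4 x hx, hde _ (hm4 x hx)]
  have hd6 : ∀ x ∈ D, ‖S (e.symm (T (f (T.symm (S.symm x))))) - x‖ ≤ 10 * ε := fun x hx => by
    have h1 := norm_coordHomeo_sub_le i le_rfl (fun a b => by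
      simpa using abs_compressLine_sub_le a b)
      (e.symm (T (f (T.symm (S.symm x))))) (S.symm x)
    rw [← hS, S.apply_symm_apply] at h1
    linarith [hd5 x hx]
  have hm6 : ∀ x ∈ D, S (e.symm (T (f (T.symm (S.symm x))))) ∈ Ω := by
    intro x hx
    refine mem_slab_of_norm_sub_le (r := r) (y := x) ?_ (hd6 x hx) (by linarith)
    obtain ⟨hxJ, h1, h2⟩ := hx
    intro j hj
    by_cases hji : j = i
    · subst hji
      rw [abs_lt]
      constructor <;> linarith
    · exact hxJ j ((Finset.mem_insert.1 hj).resolve_left hji)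
  refine ⟨fun x => f (S (e.symm (T (f (T.symm (S.symm x)))))), ⟨?_, ?_, ?_⟩, ?_, ?_, ?_⟩
  · have l1 : IsLocalHomeomorphOn (fun x => f (T.symm (S.symm x))) D :=
      hf.isLocalHomeomorphOn.comp
        ((S.symm.trans T.symm).isLocalHomeomorph.isLocalHomeomorphOn.mono (subset_univ D)) hm12
    have l2 : IsLocalHomeomorphOn (fun x => T (f (T.symm (S.symm x)))) D :=
      T.isLocalHomeomorph.isLocalHomeomorphOn.comp l1 (mapsTo_univ _ _)
    have l3 : IsLocalHomeomorphOn (fun x => e.symm (T (f (T.symm (S.symm x))))) D :=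
      IsLocalHomeomorphOn.comp (t := e.target) (fun y hy => ⟨e.symm, hy, rfl⟩) l2 hm4
    have l4 : IsLocalHomeomorphOn (fun x => S (e.symm (T (f (T.symm (S.symm x)))))) D :=
      S.isLocalHomeomorph.isLocalHomeomorphOn.comp l3 (mapsTo_univ _ _)
    exact hf.isLocalHomeomorphOn.comp l4 hm6
  · intro x hx y hy hxy
    have h1 := S.injective (hf.injOn (hm6 x hx) (hm6 y hy) hxy)
    have h2 := T.injective (e.symm.injOn (hm4 x hx) (hm4 y hy) h1)
    exact S.symm.injective (T.symm.injective (hf.injOn (hm12 x hx) (hm12 y hy) h2))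
  · intro x hx
    have h1 := norm_sub_le_norm_sub_add_norm_sub (f (S (e.symm (T (f (T.symm (S.symm x)))))))
      (S (e.symm (T (f (T.symm (S.symm x)))))) x
    linarith [hd6 x hx, hf.norm_sub_le _ (hm6 x hx)]
  · intro x hxJ h1 h2
    have hx : x ∈ D := ⟨hxJ, by linarith, h2⟩
    have hp : 4 ≤ S.symm x i := by
      rw [hSi', compressLine_symm_apply]
      simp only [max_def, min_def]
      split_ifs <;> linarith
    have e1 : T.symm (S.symm x) = S.symm x := by
      ext j
      by_cases hji : j = i
      · subst hji
        rw [hTi', expandLine_symm_apply]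
        simp only [max_def, min_def]
        split_ifs <;> linarith
      · exact hTj' _ _ hji
    have hm := hm12 x hx
    rw [e1] at hm
    have e2 : T (f (S.symm x)) = f (S.symm x) := by
      have h3 := abs_le.1 (abs_apply_sub_le (hf.norm_sub_le _ hm) i)
      ext j
      by_cases hji : j = i
      · subst hji
        rw [hTi, expandLine_apply]
        simp only [max_def, min_def]
        split_ifs <;> linarith
      · exact hTj _ _ hji
    simp only [e1, e2, hef' _ hm, S.apply_symm_apply]
  · intro x hxJ h1 h2
    have hx : x ∈ D := ⟨hxJ, h1, by linarith⟩
    have e1 : S.symm x = x := by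
      ext j
      by_cases hji : j = i
      · subst hji
        rw [hSi', compressLine_symm_apply]
        simp only [max_def, min_def]
        split_ifs <;> linarith
      · exact hSj' _ _ hji
    have e2 : T.symm x = x + Pi.single i 8 := by
      ext j
      by_cases hji : j = i
      · subst hji
        rw [hTi', expandLine_symm_apply, Pi.add_apply, Pi.single_eq_same]
        simp only [max_def, min_def]
        split_ifs <;> linarith
      · rw [hTj' _ _ hji, Pi.add_apply, Pi.single_eq_of_ne hji, add_zero]
    have hm := hm12 x hx
    rw [e1, e2] at hm
    have h3 := abs_le.1 (abs_apply_sub_le (hf.norm_sub_le _ hm) i)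
    rw [Pi.add_apply, Pi.single_eq_same] at h3
    have e3 : T (f (x + Pi.single i 8)) = f (x + Pi.single i 8) - Pi.single i 8 := by
      ext j
      by_cases hji : j = i
      · subst hji
        rw [hTi, expandLine_apply, Pi.sub_apply, Pi.single_eq_same]
        simp only [max_def, min_def]
        split_ifs <;> linarith
      · rw [hTj _ _ hji, Pi.sub_apply, Pi.single_eq_of_ne hji, sub_zero]
    have hm' := hm4 x hx
    rw [e1, e2, e3] at hm'
    have h4 := abs_le.1 (abs_apply_sub_le (hde _ hm') i)
    rw [Pi.sub_apply, Pi.single_eq_same] at h4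
    have e4 : S (e.symm (f (x + Pi.single i 8) - Pi.single i 8)) =
        e.symm (f (x + Pi.single i 8) - Pi.single i 8) := by
      ext j
      by_cases hji : j = i
      · subst hji
        rw [hSi, compressLine_apply]
        simp only [max_def, min_def]
        split_ifs <;> linarith
      · exact hSj _ _ hji
    simp only [e1, e2, e3, e4, hfe _ hm']
  · rintro Z hZ hfZ x ⟨hxZ, hxJ⟩ h1 h2
    have hx : x ∈ D := ⟨hxJ, h1, h2⟩
    have e1 : f (T.symm (S.symm x)) = T.symm (S.symm x) :=
      hfZ _ ⟨hZ x hxZ _ fun j hj => by rw [hTj' _ _ hj, hSj' _ _ hj], hm12 x hx⟩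
    have hm := hm6 x hx
    have hm' := hm4 x hx
    rw [e1, T.apply_symm_apply] at hm hm'
    have hs : S.symm x ∈ Ω := by
      intro j hj
      by_cases hji : j = i
      · subst hji
        rw [hSi', compressLine_symm_apply, abs_lt]
        simp only [max_def, min_def]
        constructor <;> split_ifs <;> linarith
      · rw [hSj' _ _ hji]
        linarith [hxJ j ((Finset.mem_insert.1 hj).resolve_left hji)]
    have e2 : e.symm (S.symm x) = S.symm x := by
      have h3 : f (S.symm x) = S.symm x := hfZ _ ⟨hZ x hxZ _ fun j hj => hSj' _ _ hj, hs⟩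
      have h4 := hef' _ hs
      rwa [h3] at h4
    rw [e2, S.apply_symm_apply] at hm
    simp only [e1, T.apply_symm_apply, e2, S.apply_symm_apply]
    exact hfZ x ⟨hxZ, hm⟩

end Interpolation

section Extension

variable {ι : Type*}

lemma add_single_mem_slab [DecidableEq ι] {J : Finset ι} {i : ι} (hi : i ∉ J) {r : ℝ}
    {x : ι → ℝ} (a : ℝ) (hx : x ∈ slab J r) : x + Pi.single i a ∈ slab J r := fun j hj => by
  rw [Pi.add_apply, Pi.single_eq_of_ne (ne_of_mem_of_not_mem hj hi), add_zero]
  exact hx j hj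

variable [Fintype ι]

/-- A map defined on a slightly enlarged period of a translation and compatible with it extends
periodically. -/
lemma exists_periodic_extension [DecidableEq ι] {J : Finset ι} {i : ι} (hi : i ∉ J) {r δ : ℝ}
    (hδ : δ ≤ 1 / 4) {Φ : (ι → ℝ) → (ι → ℝ)}
    (hΦ : IsNearEmbedding Φ {x | x ∈ slab J r ∧ -10 < x i ∧ x i < 2} δ)
    (hper : ∀ x ∈ slab J r, -1 ≤ x i → x i < 1 →
      Φ (x + Pi.single i (-8)) = Φ x + Pi.single i (-8)) :
    ∃ F : (ι → ℝ) → (ι → ℝ), IsNearEmbedding F (slab J r) δ ∧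
      ∀ x ∈ slab J r, ∀ m : ℤ, -9 ≤ x i - 8 * m → x i - 8 * m < 1 →
        F x = Φ (x + Pi.single i (-8 * m : ℝ)) + Pi.single i (8 * m : ℝ) := by
  have hsingle : ∀ a b : ℝ, (Pi.single i a + Pi.single i b : ι → ℝ) = Pi.single i (a + b) :=
    fun a b => (Pi.single_add (f := fun _ : ι => ℝ) i a b).symm
  set G : ℤ → (ι → ℝ) → (ι → ℝ) := fun m x =>
    Φ (x + Pi.single i (-8 * m : ℝ)) + Pi.single i (8 * m : ℝ) with hG
  have hstep : ∀ x ∈ slab J r, ∀ m : ℤ, -1 ≤ x i - 8 * m → x i - 8 * m < 1 →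
      G (m + 1) x = G m x := by
    intro x hx m h1 h2
    have h3 := hper (x + Pi.single i (-8 * m : ℝ)) (add_single_mem_slab hi _ hx)
      (by rw [Pi.add_apply, Pi.single_eq_same]; linarith)
      (by rw [Pi.add_apply, Pi.single_eq_same]; linarith)
    rw [add_assoc, hsingle] at h3
    simp only [hG]
    rw [show (-8 * ((m + 1 : ℤ) : ℝ)) = -8 * m + -8 by push_cast; ring, h3, add_assoc, hsingle]
    congr 2
    push_cast; ring
  have hceil : ∀ t : ℝ, -8 < t - 8 * ⌈t / 8⌉ ∧ t - 8 * ⌈t / 8⌉ ≤ 0 := fun t =>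
    ⟨by linarith [Int.ceil_lt_add_one (t / 8)], by linarith [Int.le_ceil (t / 8)]⟩
  have hF : ∀ x ∈ slab J r, ∀ m : ℤ, -9 ≤ x i - 8 * m → x i - 8 * m < 1 →
      G ⌈x i / 8⌉ x = G m x := by
    intro x hx m h1 h2
    obtain ⟨h3, h4⟩ := hceil (x i)
    have h5 : ((⌈x i / 8⌉ : ℤ) : ℝ) < ((m + 2 : ℤ) : ℝ) := by push_cast; linarith
    have h6 : ((m : ℤ) : ℝ) < ((⌈x i / 8⌉ + 2 : ℤ) : ℝ) := by push_cast; linarith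
    have h7 : ⌈x i / 8⌉ = m ∨ ⌈x i / 8⌉ = m + 1 ∨ m = ⌈x i / 8⌉ + 1 := by
      have := Int.cast_lt.1 h5
      have := Int.cast_lt.1 h6
      omega
    rcases h7 with h7 | h7 | h7
    · rw [h7]
    · rw [h7] at h3 h4 ⊢
      push_cast at h3 h4
      exact hstep x hx m (by linarith) (by linarith)
    · conv_rhs => rw [h7]
      rw [h7] at h1 h2
      push_cast at h1 h2
      exact (hstep x hx _ (by linarith) (by linarith)).symm
  have hmem : ∀ x ∈ slab J r, ∀ m : ℤ, -10 < x i - 8 * m → x i - 8 * m < 2 →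
      x + Pi.single i (-8 * m : ℝ) ∈ {x | x ∈ slab J r ∧ -10 < x i ∧ x i < 2} := by
    intro x hx m h1 h2
    refine ⟨add_single_mem_slab hi _ hx, ?_, ?_⟩ <;>
      rw [Pi.add_apply, Pi.single_eq_same] <;> linarith
  have hnear : ∀ x ∈ slab J r, ‖G ⌈x i / 8⌉ x - x‖ ≤ δ := by
    intro x hx
    obtain ⟨h3, h4⟩ := hceil (x i)
    have h5 := hΦ.norm_sub_le _ (hmem x hx ⌈x i / 8⌉ (by linarith) (by linarith))
    convert h5 using 2
    simp only [hG]
    rw [show (-8 * (⌈x i / 8⌉ : ℝ)) = -(8 * (⌈x i / 8⌉ : ℝ)) by ring, Pi.single_neg]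
    abel
  refine ⟨fun x => G ⌈x i / 8⌉ x, ⟨?_, ?_, hnear⟩, hF⟩
  · refine isLocalHomeomorphOn_of_locally_eqOn fun x hx => ?_
    obtain ⟨h3, h4⟩ := hceil (x i)
    set m := ⌈x i / 8⌉
    refine ⟨G m, {y | y ∈ slab J r ∧ -9 < y i - 8 * m ∧ y i - 8 * m < 1}, ?_,
      ⟨hx, by linarith, by linarith⟩, ?_, fun y hy => hF y hy.1 m hy.2.1.le hy.2.2⟩
    · exact (isOpen_slab J r).inter
        (isOpen_Ioo.preimage (f := fun y : ι → ℝ => y i - 8 * m) (by fun_prop))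
    · have l1 : IsLocalHomeomorphOn (fun y => Φ (y + Pi.single i (-8 * m : ℝ)))
          {y | y ∈ slab J r ∧ -9 < y i - 8 * m ∧ y i - 8 * m < 1} :=
        hΦ.isLocalHomeomorphOn.comp
          ((Homeomorph.addRight (Pi.single i (-8 * m : ℝ) : ι → ℝ)
            ).isLocalHomeomorph.isLocalHomeomorphOn.mono (subset_univ _))
          fun y hy => hmem y hy.1 m (by linarith [hy.2.1]) (by linarith [hy.2.2])
      exact (Homeomorph.addRight (Pi.single i (8 * m : ℝ) : ι → ℝ)
        ).isLocalHomeomorph.isLocalHomeomorphOn.comp l1 (mapsTo_univ _ _)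
  · intro x hx y hy hxy
    simp only at hxy
    have h1 := abs_le.1 (abs_apply_sub_le (hnear x hx) i)
    have h2 := abs_le.1 (abs_apply_sub_le (hnear y hy) i)
    rw [hxy] at h1
    obtain ⟨h3, h4⟩ := hceil (x i)
    rw [hF y hy ⌈x i / 8⌉ (by linarith) (by linarith)] at hxy
    exact add_right_cancel (hΦ.injOn (hmem x hx _ (by linarith) (by linarith))
      (hmem y hy _ (by linarith) (by linarith)) (add_right_cancel hxy))

/-- A near embedding defined on a slab extends, in the direction of one of the bounded
coordinates, to a near embedding of a slab unbounded in that direction. -/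
lemma exists_unbounded_in_direction [DecidableEq ι] {J : Finset ι} {i : ι} (hi : i ∉ J) {r : ℝ}
    (hr : 20 ≤ r) {δ : ℝ} (hδ : 0 < δ) :
    ∃ ε > 0, ∀ f : (ι → ℝ) → (ι → ℝ), IsNearEmbedding f (slab (insert i J) (r + 1)) ε →
      ∃ F : (ι → ℝ) → (ι → ℝ), IsNearEmbedding F (slab J r) δ ∧
        (∀ x ∈ slab J r, |x i| < 1 → F x = f x) ∧
        ∀ Z : Set (ι → ℝ), (∀ x ∈ Z, ∀ y, (∀ j, j ≠ i → y j = x j) → y ∈ Z) →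
          (∀ x ∈ Z ∩ slab (insert i J) (r + 1), f x = x) → ∀ x ∈ Z ∩ slab J r, F x = x := by
  refine ⟨min (δ / 11) (1 / 1000), by positivity, fun f hf => ?_⟩
  have hε1 := min_le_left (δ / 11) (1 / 1000 : ℝ)
  have hε2 := min_le_right (δ / 11) (1 / 1000 : ℝ)
  obtain ⟨Φ, hΦ, hΦ1, hΦ2, hΦZ⟩ := exists_interpolate_translate hr hε2 hf
  obtain ⟨F, hF, hFΦ⟩ := exists_periodic_extension hi (by linarith) hΦ fun x hx h1 h2 => by
    have h8 : (Pi.single i (-8 : ℝ) : ι → ℝ) = -Pi.single i 8 := Pi.single_neg i 8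
    rw [hΦ1 x hx h1 (by linarith), hΦ2 _ (add_single_mem_slab hi _ hx), h8,
      neg_add_cancel_right, sub_eq_add_neg] <;>
    · rw [Pi.add_apply, Pi.single_eq_same]
      linarith
  refine ⟨F, ⟨hF.isLocalHomeomorphOn, hF.injOn, fun x hx => (hF.norm_sub_le x hx).trans
    (by linarith)⟩, fun x hx hxi => ?_, fun Z hZ hfZ x hx => ?_⟩
  · obtain ⟨h1, h2⟩ := abs_lt.1 hxi
    rw [hFΦ x hx 0 (by simp; linarith) (by simp; linarith)]
    simpa using hΦ1 x hx h1.le (by linarith)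
  · have h1 := Int.ceil_lt_add_one (x i / 8)
    have h2 := Int.le_ceil (x i / 8)
    rw [hFΦ x hx.2 ⌈x i / 8⌉ (by linarith) (by linarith), hΦZ Z hZ hfZ _
      ⟨hZ x hx.1 _ fun j hj => by simp [hj], add_single_mem_slab hi _ hx.2⟩, add_assoc,
      ← Pi.single_add]
    · simp
    all_goals
      rw [Pi.add_apply, Pi.single_eq_same]
      linarith

/-- A near embedding defined on a neighbourhood of a coordinate subspace agrees near that
subspace with a near embedding of the whole space. -/
lemma exists_isNearEmbedding_univ [DecidableEq ι] (K J : Finset ι) (hKJ : Disjoint K J) :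
    ∀ δ > (0 : ℝ), ∃ ε > 0, ∀ f : (ι → ℝ) → (ι → ℝ), IsNearEmbedding f (slab J (20 + J.card)) ε →
      (∀ x ∈ slab J (20 + J.card), (∃ k ∈ K, 1 ≤ |x k|) → f x = x) →
      ∃ F : (ι → ℝ) → (ι → ℝ), IsNearEmbedding F univ δ ∧
        (∀ x ∈ slab J 1, F x = f x) ∧ ∀ x, (∃ k ∈ K, 1 ≤ |x k|) → F x = x := by
  induction J using Finset.induction_on with
  | empty =>
    intro δ hδ
    have hu : ∀ r, slab (∅ : Finset ι) r = univ := fun r => by ext; simp [slab]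
    refine ⟨δ, hδ, fun f hf hfK => ⟨f, by simpa [hu] using hf, fun _ _ => rfl, fun x => hfK x ?_⟩⟩
    simp [hu]
  | insert i J hi ih =>
    intro δ hδ
    rw [Finset.disjoint_insert_right] at hKJ
    obtain ⟨ε', hε', H'⟩ := ih hKJ.2 δ hδ
    obtain ⟨ε, hε, H⟩ := exists_unbounded_in_direction hi (r := 20 + J.card) (by simp) hε'
    have hcard : (20 + ((insert i J).card : ℝ)) = 20 + J.card + 1 := by
      rw [Finset.card_insert_of_notMem hi]; push_cast; ring
    rw [hcard]
    refine ⟨ε, hε, fun f hf hfK => ?_⟩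
    obtain ⟨F₁, hF₁, hF₁f, hF₁Z⟩ := H f hf
    obtain ⟨F, hF, hFF₁, hFK⟩ := H' F₁ hF₁ fun x hx hxK => hF₁Z {x | ∃ k ∈ K, 1 ≤ |x k|}
      (by
        rintro y ⟨k, hk, hyk⟩ z hz
        exact ⟨k, hk, by rwa [hz k (ne_of_mem_of_not_mem hk hKJ.1)]⟩)
      (fun y hy => hfK y hy.2 hy.1) x ⟨hxK, hx⟩
    refine ⟨F, hF, fun x hx => ?_, hFK⟩
    have hxJ : x ∈ slab J 1 := fun j hj => hx j (Finset.mem_insert_of_mem hj)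
    rw [hFF₁ x hxJ]
    refine hF₁f x (fun j hj => (hxJ j hj).trans ?_) (hx i (Finset.mem_insert_self i J))
    have : (0 : ℝ) ≤ J.card := by positivity
    linarith

end Extension

section Squeeze

variable {E : Type*} [NormedAddCommGroup E]

/-- The factor by which `squeezeMap` divides vectors. -/
noncomputable def squeezeFactor (x : E) : ℝ := 1 + max (‖x‖ - 2) 0 / 4

/-- The factor by which `unsqueezeMap` multiplies vectors. -/
noncomputable def unsqueezeFactor (y : E) : ℝ := max 1 (2 / (4 - ‖y‖))

lemma one_le_squeezeFactor (x : E) : 1 ≤ squeezeFactor x := by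
  have := le_max_right (‖x‖ - 2) 0
  unfold squeezeFactor; linarith

lemma squeezeFactor_of_norm_le {x : E} (hx : ‖x‖ ≤ 2) : squeezeFactor x = 1 := by
  rw [squeezeFactor, max_eq_right (by linarith), zero_div, add_zero]

lemma unsqueezeFactor_of_norm_le {x : E} (hx : ‖x‖ ≤ 2) : unsqueezeFactor x = 1 := by
  refine max_eq_left ?_
  rw [div_le_one (by linarith)]
  linarith

variable [NormedSpace ℝ E]

/-- A radial homeomorphism of a normed space onto its ball of radius `4`, the identity on the
ball of radius `2`. -/
noncomputable def squeezeMap (x : E) : E := (squeezeFactor x)⁻¹ • x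

/-- The inverse of `squeezeMap` on the ball of radius `4`. -/
noncomputable def unsqueezeMap (y : E) : E := unsqueezeFactor y • y

lemma norm_squeezeMap (x : E) : ‖squeezeMap x‖ = ‖x‖ / squeezeFactor x := by
  have := one_le_squeezeFactor x
  rw [squeezeMap, norm_smul, norm_inv, Real.norm_of_nonneg (by linarith), inv_mul_eq_div]

lemma norm_squeezeMap_lt (x : E) : ‖squeezeMap x‖ < 4 := by
  have h1 := one_le_squeezeFactor x
  rw [norm_squeezeMap, div_lt_iff₀ (by linarith)]
  have := le_max_left (‖x‖ - 2) 0
  unfold squeezeFactor; linarith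

lemma squeezeMap_of_norm_le {x : E} (hx : ‖x‖ ≤ 2) : squeezeMap x = x := by
  rw [squeezeMap, squeezeFactor_of_norm_le hx, inv_one, one_smul]

lemma unsqueezeMap_of_norm_le {x : E} (hx : ‖x‖ ≤ 2) : unsqueezeMap x = x := by
  rw [unsqueezeMap, unsqueezeFactor_of_norm_le hx, one_smul]

lemma unsqueezeFactor_squeezeMap (x : E) : unsqueezeFactor (squeezeMap x) = squeezeFactor x := by
  rcases le_total ‖x‖ 2 with hx | hx
  · rw [squeezeMap_of_norm_le hx, unsqueezeFactor_of_norm_le hx, squeezeFactor_of_norm_le hx]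
  · have h : squeezeFactor x = (‖x‖ + 2) / 4 := by
      rw [squeezeFactor, max_eq_left (by linarith)]; ring
    have h2 : 2 / (4 - ‖squeezeMap x‖) = (‖x‖ + 2) / 4 := by
      rw [norm_squeezeMap, h]
      have : (4 : ℝ) - ‖x‖ / ((‖x‖ + 2) / 4) = 8 / (‖x‖ + 2) := by field_simp; ring
      rw [this]; field_simp; norm_num
    rw [unsqueezeFactor, h2, h, max_eq_right (by linarith)]

lemma unsqueezeMap_squeezeMap (x : E) : unsqueezeMap (squeezeMap x) = x := by
  have := one_le_squeezeFactor x
  rw [unsqueezeMap, unsqueezeFactor_squeezeMap, squeezeMap, smul_inv_smul₀ (by linarith)]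

lemma squeezeFactor_unsqueezeMap {y : E} (hy : ‖y‖ < 4) :
    squeezeFactor (unsqueezeMap y) = unsqueezeFactor y := by
  rcases le_total ‖y‖ 2 with h | h
  · rw [unsqueezeMap_of_norm_le h, unsqueezeFactor_of_norm_le h, squeezeFactor_of_norm_le h]
  · have h0 : 0 < 4 - ‖y‖ := by linarith
    have h1 : unsqueezeFactor y = 2 / (4 - ‖y‖) :=
      max_eq_right (by rw [le_div_iff₀ h0]; linarith)
    have h2 : ‖unsqueezeMap y‖ = 2 / (4 - ‖y‖) * ‖y‖ := by
      rw [unsqueezeMap, h1, norm_smul, Real.norm_of_nonneg (by positivity)]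
    rw [squeezeFactor, h2, h1, max_eq_left]
    · field_simp; ring
    · rw [div_mul_eq_mul_div, sub_nonneg, le_div_iff₀ h0]; linarith

lemma squeezeMap_unsqueezeMap {y : E} (hy : ‖y‖ < 4) : squeezeMap (unsqueezeMap y) = y := by
  have : 1 ≤ unsqueezeFactor y := le_max_left _ _
  rw [squeezeMap, squeezeFactor_unsqueezeMap hy, unsqueezeMap, inv_smul_smul₀ (by linarith)]

lemma continuous_squeezeMap : Continuous (squeezeMap : E → E) := by
  have h : Continuous (squeezeFactor : E → ℝ) := by unfold squeezeFactor; fun_prop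
  exact (h.inv₀ fun x => by linarith [one_le_squeezeFactor x]).smul continuous_id

lemma continuousAt_unsqueezeMap {y : E} (hy : ‖y‖ < 4) : ContinuousAt unsqueezeMap y := by
  have h : ContinuousAt (unsqueezeFactor : E → ℝ) y :=
    continuousAt_const.max (continuousAt_const.div (by fun_prop) (by linarith))
  exact h.smul continuousAt_id

lemma norm_squeezeMap_sub_le (x y : E) :
    ‖squeezeMap x - squeezeMap y‖ ≤ 2 / squeezeFactor y * ‖x - y‖ := by
  have hx := one_le_squeezeFactor x
  have hy := one_le_squeezeFactor y
  have hq : |squeezeFactor y - squeezeFactor x| ≤ ‖x - y‖ / 4 := by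
    have h1 : |max (‖y‖ - 2) 0 - max (‖x‖ - 2) 0| ≤ |(‖y‖ - 2) - (‖x‖ - 2)| :=
      abs_max_sub_max_le_abs _ _ _
    have h2 : |(‖y‖ - 2) - (‖x‖ - 2)| ≤ ‖x - y‖ := by
      rw [sub_sub_sub_cancel_right, norm_sub_rev]; exact abs_norm_sub_norm_le y x
    have h3 : squeezeFactor y - squeezeFactor x = (max (‖y‖ - 2) 0 - max (‖x‖ - 2) 0) / 4 := by
      unfold squeezeFactor; ring
    rw [h3, abs_div, abs_of_pos (by norm_num : (0 : ℝ) < 4)]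
    linarith
  have hdecomp : squeezeMap x - squeezeMap y =
      (squeezeFactor y)⁻¹ • (x - y) +
        ((squeezeFactor y)⁻¹ * (squeezeFactor y - squeezeFactor x)) • squeezeMap x := by
    simp only [squeezeMap]
    rw [smul_sub, smul_smul]
    have : (squeezeFactor y)⁻¹ * (squeezeFactor y - squeezeFactor x) * (squeezeFactor x)⁻¹ =
        (squeezeFactor x)⁻¹ - (squeezeFactor y)⁻¹ := by
      field_simp
    rw [this, sub_smul]; abel
  rw [hdecomp]
  refine (norm_add_le _ _).trans ?_
  rw [norm_smul, norm_smul, norm_mul, norm_inv,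
    Real.norm_of_nonneg (by linarith : 0 ≤ squeezeFactor y),
    Real.norm_eq_abs]
  have h4 : |squeezeFactor y - squeezeFactor x| * ‖squeezeMap x‖ ≤ ‖x - y‖ / 4 * 4 :=
    mul_le_mul hq (norm_squeezeMap_lt x).le (norm_nonneg _) (by positivity)
  have h5 : 0 ≤ (squeezeFactor y)⁻¹ := by positivity
  calc (squeezeFactor y)⁻¹ * ‖x - y‖ +
        (squeezeFactor y)⁻¹ * |squeezeFactor y - squeezeFactor x| * ‖squeezeMap x‖
      = (squeezeFactor y)⁻¹ * (‖x - y‖ + |squeezeFactor y - squeezeFactor x| * ‖squeezeMap x‖) := by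
        ring
    _ ≤ (squeezeFactor y)⁻¹ * (‖x - y‖ + ‖x - y‖ / 4 * 4) := by gcongr
    _ = 2 / squeezeFactor y * ‖x - y‖ := by ring

open Classical in
/-- The conjugate of `F` by `squeezeMap`, extended by the identity outside of the ball of
radius `4`. -/
noncomputable def squeezed (F : E → E) (x : E) : E :=
  if ‖x‖ < 4 then squeezeMap (F (unsqueezeMap x)) else x

lemma squeezed_of_le (F : E → E) {x : E} (hx : 4 ≤ ‖x‖) : squeezed F x = x :=
  if_neg hx.not_gt

lemma squeezed_of_lt (F : E → E) {x : E} (hx : ‖x‖ < 4) :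
    squeezed F x = squeezeMap (F (unsqueezeMap x)) := if_pos hx

lemma squeezed_squeezed {F G : E → E} (h : ∀ x, F (G x) = x) (x : E) :
    squeezed F (squeezed G x) = x := by
  rcases lt_or_ge ‖x‖ 4 with hx | hx
  · rw [squeezed_of_lt G hx, squeezed_of_lt F (norm_squeezeMap_lt _), unsqueezeMap_squeezeMap, h,
      squeezeMap_unsqueezeMap hx]
  · rw [squeezed_of_le G hx, squeezed_of_le F hx]

lemma norm_squeezed_sub_le {F : E → E} {δ : ℝ} (hF : ∀ x, ‖F x - x‖ ≤ δ) (x : E) :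
    ‖squeezed F x - x‖ ≤ δ * max 0 (4 - ‖x‖) := by
  have hδ : 0 ≤ δ := (norm_nonneg _).trans (hF 0)
  rcases lt_or_ge ‖x‖ 4 with hx | hx
  · have h1 := norm_squeezeMap_sub_le (F (unsqueezeMap x)) (unsqueezeMap x)
    rw [squeezeMap_unsqueezeMap hx, squeezeFactor_unsqueezeMap hx] at h1
    rw [squeezed_of_lt F hx, max_eq_right (by linarith)]
    have h2 : 2 / (4 - ‖x‖) ≤ unsqueezeFactor x := le_max_right _ _
    have h0 : 0 < 4 - ‖x‖ := by linarith
    have h3 : 2 / unsqueezeFactor x ≤ 4 - ‖x‖ := by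
      have : 0 < unsqueezeFactor x := lt_of_lt_of_le one_pos (le_max_left _ _)
      rw [div_le_iff₀ h0] at h2
      rw [div_le_iff₀ this]; linarith
    calc _ ≤ _ := h1
      _ ≤ (4 - ‖x‖) * δ := mul_le_mul h3 (hF _) (norm_nonneg _) h0.le
      _ = _ := mul_comm _ _
  · rw [squeezed_of_le F hx, sub_self, norm_zero]; positivity

lemma continuous_squeezed {F : E → E} {δ : ℝ} (hFc : Continuous F) (hF : ∀ x, ‖F x - x‖ ≤ δ) :
    Continuous (squeezed F) := by
  refine continuous_iff_continuousAt.2 fun x => ?_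
  rcases lt_or_ge ‖x‖ 4 with hx | hx
  · have h : squeezed F =ᶠ[𝓝 x] fun y => squeezeMap (F (unsqueezeMap y)) := by
      filter_upwards [(isOpen_lt continuous_norm continuous_const).mem_nhds hx] with y hy
      exact squeezed_of_lt F hy
    refine ContinuousAt.congr ?_ h.symm
    exact continuous_squeezeMap.continuousAt.comp
      (hFc.continuousAt.comp (continuousAt_unsqueezeMap hx))
  · have h0 : Tendsto (fun y : E => δ * max 0 (4 - ‖y‖)) (𝓝 x) (𝓝 0) := by
      have : Continuous fun y : E => δ * max 0 (4 - ‖y‖) := by fun_prop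
      simpa [hx] using this.tendsto x
    have h1 : Tendsto (fun y => squeezed F y - y) (𝓝 x) (𝓝 0) :=
      squeeze_zero_norm (norm_squeezed_sub_le hF) h0
    have h2 := h1.add (tendsto_id (x := 𝓝 x))
    simp only [id, sub_add_cancel, zero_add] at h2
    rw [ContinuousAt, squeezed_of_le F hx]
    exact h2

/-- The squeezed homeomorphism of a homeomorphism at bounded distance from the identity. -/
noncomputable def squeezedHomeo (e : E ≃ₜ E) {δ : ℝ} (he : ∀ x, ‖e x - x‖ ≤ δ) : E ≃ₜ E where
  toFun := squeezed e
  invFun := squeezed e.symm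
  left_inv := squeezed_squeezed e.symm_apply_apply
  right_inv := squeezed_squeezed e.apply_symm_apply
  continuous_toFun := continuous_squeezed e.continuous he
  continuous_invFun := continuous_squeezed (δ := δ) e.symm.continuous fun x => by
    have := he (e.symm x)
    rwa [e.apply_symm_apply, norm_sub_rev] at this

open Classical in
/-- The Alexander isotopy from the identity (at time `0`) to `g` (at time `1`). -/
noncomputable def alexander (g : E → E) (t : ℝ) (x : E) : E :=
  if t = 0 then x else t • g (t⁻¹ • x)

lemma alexander_zero (g : E → E) (x : E) : alexander g 0 x = x := if_pos rfl

lemma alexander_one (g : E → E) (x : E) : alexander g 1 x = g x := by simp [alexander]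

lemma alexander_alexander {f g : E → E} (h : ∀ x, f (g x) = x) (t : ℝ) (x : E) :
    alexander f t (alexander g t x) = x := by
  by_cases ht : t = 0
  · simp [alexander, ht]
  · simp [alexander, ht, h]

lemma alexander_of_le {g : E → E} {R : ℝ} (hg : ∀ x, R ≤ ‖x‖ → g x = x) {t : ℝ} (ht : |t| ≤ 1)
    {x : E} (hx : R ≤ ‖x‖) : alexander g t x = x := by
  by_cases h : t = 0
  · simp [alexander, h]
  · have h1 : R ≤ ‖t⁻¹ • x‖ := by
      rw [norm_smul, norm_inv, Real.norm_eq_abs]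
      exact hx.trans (le_mul_of_one_le_left (norm_nonneg x)
        ((one_le_inv₀ (abs_pos.2 h)).2 ht))
    simp [alexander, h, hg _ h1]

lemma continuous_alexander {g : E → E} {δ : ℝ} (hgc : Continuous g) (hg : ∀ x, ‖g x - x‖ ≤ δ) :
    Continuous fun p : E × ℝ => alexander g p.2 p.1 := by
  refine continuous_iff_continuousAt.2 fun ⟨x, t⟩ => ?_
  by_cases ht : t = 0
  · subst ht
    have hb : ∀ p : E × ℝ, ‖alexander g p.2 p.1 - p.1‖ ≤ |p.2| * δ := by
      rintro ⟨y, s⟩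
      by_cases hs : s = 0
      · simp [alexander, hs]
      · have : alexander g s y - y = s • (g (s⁻¹ • y) - s⁻¹ • y) := by
          simp [alexander, hs, smul_sub]
        rw [this, norm_smul, Real.norm_eq_abs]
        gcongr
        exact hg _
    have h0 : Tendsto (fun p : E × ℝ => |p.2| * δ) (𝓝 (x, 0)) (𝓝 0) := by
      have : Continuous fun p : E × ℝ => |p.2| * δ := by fun_prop
      simpa using this.tendsto (x, 0)
    have h1 := (squeeze_zero_norm hb h0).add (continuous_fst.tendsto (x, (0 : ℝ)))
    simp only [sub_add_cancel, zero_add] at h1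
    rw [ContinuousAt, alexander_zero]
    exact h1
  · have h : (fun p : E × ℝ => alexander g p.2 p.1) =ᶠ[𝓝 (x, t)]
        fun p => p.2 • g (p.2⁻¹ • p.1) := by
      filter_upwards [(isOpen_ne.preimage continuous_snd).mem_nhds
        (show (x, t) ∈ Prod.snd ⁻¹' {y : ℝ | y ≠ 0} from ht)] with p hp
      exact if_neg hp
    refine ContinuousAt.congr ?_ h.symm
    have h1 : ContinuousAt (fun p : E × ℝ => p.2⁻¹ • p.1) (x, t) :=
      (continuousAt_snd.inv₀ ht).smul continuousAt_fst
    exact continuousAt_snd.smul (hgc.continuousAt.comp h1)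

end Squeeze

section Straightening

variable {ι : Type*} [Fintype ι]

lemma IsNearEmbedding.exists_homeomorph {F : (ι → ℝ) → (ι → ℝ)} {δ : ℝ}
    (hF : IsNearEmbedding F univ δ) : ∃ e : (ι → ℝ) ≃ₜ (ι → ℝ), ⇑e = F := by
  have hsurj : Function.Surjective F := by
    have := hF.subset_image isOpen_univ isPreconnected_univ (fun _ _ => subset_univ _)
      (mem_univ 0) (mem_univ _)
    rwa [image_univ, univ_subset_iff, range_eq_univ] at this
  have hloc : IsLocalHomeomorph F :=
    isLocalHomeomorph_iff_isLocalHomeomorphOn_univ.2 hF.isLocalHomeomorphOn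
  exact ⟨hloc.toHomeomorphOfBijective ⟨injOn_univ.1 hF.injOn, hsurj⟩, rfl⟩

/-- Straightening of handles: a near embedding of a neighbourhood of a coordinate cube which is
the identity beyond the boundary of the cube agrees near the cube with a compactly supported
homeomorphism close to the identity. -/
lemma exists_homeomorph_eqOn_ball [DecidableEq ι] (K : Finset ι) {δ : ℝ} (hδ : 0 < δ) :
    ∃ ε > 0, ∀ f : (ι → ℝ) → (ι → ℝ), IsNearEmbedding f (slab Kᶜ (20 + Kᶜ.card)) ε →
      (∀ x ∈ slab Kᶜ (20 + Kᶜ.card), (∃ k ∈ K, 1 ≤ |x k|) → f x = x) →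
      ∃ g : (ι → ℝ) ≃ₜ (ι → ℝ), (∀ x, ‖g x - x‖ ≤ δ) ∧ (∀ x, 4 ≤ ‖x‖ → g x = x) ∧
        (∀ x, (∃ k ∈ K, 1 ≤ |x k|) → g x = x) ∧ ∀ x, ‖x‖ < 1 → g x = f x := by
  obtain ⟨ε, hε, H⟩ := exists_isNearEmbedding_univ K Kᶜ disjoint_compl_right
    (min (δ / 4) 1) (by positivity)
  refine ⟨ε, hε, fun f hf hfK => ?_⟩
  obtain ⟨F, hF, hFf, hFK⟩ := H f hf hfK
  obtain ⟨e, rfl⟩ := hF.exists_homeomorph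
  have he : ∀ x, ‖e x - x‖ ≤ min (δ / 4) 1 := fun x => hF.norm_sub_le x (mem_univ x)
  refine ⟨squeezedHomeo e he, fun x => ?_, fun x hx => squeezed_of_le e hx, ?_, fun x hx => ?_⟩
  · have h1 := norm_squeezed_sub_le (fun x => (he x).trans (min_le_left _ _)) x
    have h2 : max 0 (4 - ‖x‖) ≤ 4 := max_le (by norm_num) (by linarith [norm_nonneg x])
    calc _ ≤ _ := h1
      _ ≤ δ / 4 * 4 := by gcongr
      _ = δ := by ring
  · rintro x ⟨k, hk, hxk⟩
    rcases lt_or_ge ‖x‖ 4 with hx | hx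
    · have h1 : e (unsqueezeMap x) = unsqueezeMap x := by
        refine hFK _ ⟨k, hk, ?_⟩
        have h2 : 1 ≤ unsqueezeFactor x := le_max_left _ _
        rw [unsqueezeMap, Pi.smul_apply, smul_eq_mul, abs_mul, abs_of_nonneg (by linarith)]
        nlinarith
      exact (squeezed_of_lt e hx).trans (by rw [h1, squeezeMap_unsqueezeMap hx])
    · exact squeezed_of_le e hx
  · have h1 : e x = f x := hFf x fun j _ => (norm_le_pi_norm x j).trans_lt hx
    refine (squeezed_of_lt e (by linarith)).trans ?_
    rw [unsqueezeMap_of_norm_le (by linarith), squeezeMap_of_norm_le, h1]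
    have h2 : ‖e x‖ ≤ ‖e x - x‖ + ‖x‖ := by simpa using norm_add_le (e x - x) x
    linarith [(he x).trans (min_le_right _ _)]

end Straightening

section Extend

variable {E M : Type*}

/-- The map of `M` which is `A` in the chart `ψ` and the identity elsewhere. -/
noncomputable def chartExtend (ψ : E → M) (A : E → E) : M → M :=
  Function.extend ψ (ψ ∘ A) id

lemma chartExtend_of_notMem_range (ψ : E → M) (A : E → E) {m : M} (hm : m ∉ range ψ) :
    chartExtend ψ A m = m :=
  Function.extend_apply' _ _ _ hm

lemma chartExtend_apply {ψ : E → M} (hψ : ψ.Injective) (A : E → E) (x : E) :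
    chartExtend ψ A (ψ x) = ψ (A x) :=
  hψ.extend_apply _ _ _

lemma chartExtend_chartExtend {ψ : E → M} (hψ : ψ.Injective) {A B : E → E}
    (h : ∀ x, A (B x) = x) (m : M) : chartExtend ψ A (chartExtend ψ B m) = m := by
  by_cases hm : m ∈ range ψ
  · obtain ⟨x, rfl⟩ := hm
    rw [chartExtend_apply hψ, chartExtend_apply hψ, h]
  · rw [chartExtend_of_notMem_range ψ B hm, chartExtend_of_notMem_range ψ A hm]

lemma chartExtend_eq_self {ψ : E → M} (hψ : ψ.Injective) {A : E → E} {m : M}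
    (h : ∀ x, ψ x = m → A x = x) : chartExtend ψ A m = m := by
  by_cases hm : m ∈ range ψ
  · obtain ⟨x, rfl⟩ := hm
    rw [chartExtend_apply hψ, h x rfl]
  · exact chartExtend_of_notMem_range ψ A hm

variable [NormedAddCommGroup E] [ProperSpace E] [TopologicalSpace M] [T2Space M]

lemma continuous_chartExtend {T : Type*} [TopologicalSpace T] {ψ : E → M}
    (hψ : IsOpenEmbedding ψ) {A : T → E → E} (hA : Continuous fun p : E × T => A p.2 p.1) {R : ℝ}
    (hR : ∀ t x, R ≤ ‖x‖ → A t x = x) :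
    Continuous fun p : M × T => chartExtend ψ (A p.2) p.1 := by
  refine continuous_iff_continuousAt.2 fun ⟨m, t⟩ => ?_
  by_cases hm : m ∈ range ψ
  · obtain ⟨x, rfl⟩ := hm
    refine ((hψ.prodMap (IsOpenEmbedding.id (X := T))).continuousAt_iff (x := (x, t))).1 ?_
    refine ((hψ.continuous.comp hA).continuousAt (x := (x, t))).congr (Eventually.of_forall ?_)
    exact fun p => (chartExtend_apply hψ.injective _ _).symm
  · have hc : IsClosed (ψ '' closedBall 0 R) :=
      ((isCompact_closedBall 0 R).image hψ.continuous).isClosed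
    have hmem : (m, t) ∈ Prod.fst ⁻¹' (ψ '' closedBall 0 R)ᶜ :=
      fun h => hm (image_subset_range _ _ h)
    refine continuousAt_fst.congr ?_
    filter_upwards [(hc.isOpen_compl.preimage continuous_fst).mem_nhds hmem] with p hp
    refine (chartExtend_eq_self hψ.injective fun x hx => hR _ _ ?_).symm
    by_contra hlt
    exact hp ⟨x, by simpa using (not_le.1 hlt).le, hx⟩

/-- The homeomorphism of `M` which is the compactly supported homeomorphism `g` in the
chart `ψ` and the identity elsewhere. -/
noncomputable def chartExtendHomeo {ψ : E → M} (hψ : IsOpenEmbedding ψ) (g : E ≃ₜ E) {R : ℝ}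
    (hg : ∀ x, R ≤ ‖x‖ → g x = x) : M ≃ₜ M where
  toFun := chartExtend ψ g
  invFun := chartExtend ψ g.symm
  left_inv := chartExtend_chartExtend hψ.injective g.symm_apply_apply
  right_inv := chartExtend_chartExtend hψ.injective g.apply_symm_apply
  continuous_toFun := (continuous_chartExtend (T := Unit) hψ (A := fun _ => g)
    (g.continuous.comp continuous_fst) (fun _ => hg)).comp
      (continuous_id.prodMk (continuous_const (y := ())))
  continuous_invFun := (continuous_chartExtend (T := Unit) hψ (A := fun _ => g.symm)
    (g.symm.continuous.comp continuous_fst)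
    (fun _ x hx => g.symm_apply_eq.2 (hg x hx).symm)).comp
      (continuous_id.prodMk (continuous_const (y := ())))

lemma chartExtendHomeo_apply {ψ : E → M} (hψ : IsOpenEmbedding ψ) (g : E ≃ₜ E) {R : ℝ}
    (hg : ∀ x, R ≤ ‖x‖ → g x = x) (m : M) : chartExtendHomeo hψ g hg m = chartExtend ψ g m := rfl

lemma chartExtendHomeo_symm_apply {ψ : E → M} (hψ : IsOpenEmbedding ψ) (g : E ≃ₜ E) {R : ℝ}
    (hg : ∀ x, R ≤ ‖x‖ → g x = x) (m : M) :
    (chartExtendHomeo hψ g hg).symm m = chartExtend ψ g.symm m := rfl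

end Extend

section Isotopy

variable {M : Type*} [TopologicalSpace M]

/-- The homeomorphism `h` is isotopic to the identity. -/
def IsotopicToId (h : M ≃ₜ M) : Prop :=
  ∃ H : C(M × I, M), (∀ x : M, H (x, 0) = h x) ∧ (∀ x : M, H (x, 1) = x) ∧
    ∀ t : I, ∃ e : M ≃ₜ M, ∀ x : M, H (x, t) = e x

lemma isotopicToId_of_forall_eq {h : M ≃ₜ M} (hh : ∀ x, h x = x) : IsotopicToId h :=
  ⟨⟨Prod.fst, continuous_fst⟩, fun x => (hh x).symm, fun _ => rfl,
    fun _ => ⟨Homeomorph.refl M, fun _ => rfl⟩⟩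

variable {E : Type*} [NormedAddCommGroup E] [NormedSpace ℝ E]

/-- The stages of the Alexander isotopy of `g`. -/
noncomputable def alexanderHomeo (g : E ≃ₜ E) {δ : ℝ} (hg : ∀ x, ‖g x - x‖ ≤ δ) (t : ℝ) :
    E ≃ₜ E where
  toFun := alexander g t
  invFun := alexander g.symm t
  left_inv := alexander_alexander g.symm_apply_apply t
  right_inv := alexander_alexander g.apply_symm_apply t
  continuous_toFun := (continuous_alexander g.continuous hg).comp
    (continuous_id.prodMk continuous_const)
  continuous_invFun := (continuous_alexander (δ := δ) g.symm.continuous fun x => by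
    have := hg (g.symm x)
    rwa [g.apply_symm_apply, norm_sub_rev] at this).comp (continuous_id.prodMk continuous_const)

lemma IsotopicToId.chartExtend_trans [ProperSpace E] [T2Space M] {h : M ≃ₜ M} (hh : IsotopicToId h)
    {ψ : E → M} (hψ : IsOpenEmbedding ψ) {g : E ≃ₜ E} {R δ : ℝ} (hg : ∀ x, R ≤ ‖x‖ → g x = x)
    (hδ : ∀ x, ‖g x - x‖ ≤ δ) : IsotopicToId ((chartExtendHomeo hψ g hg).trans h) := by
  obtain ⟨H, H0, H1, He⟩ := hh
  have habs : ∀ t : I, |(1 : ℝ) - t| ≤ 1 := fun t => by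
    rw [abs_of_nonneg (by linarith [t.2.2])]; linarith [t.2.1]
  have hR : ∀ (t : I) x, R ≤ ‖x‖ → alexander g (1 - t) x = x := fun t x hx =>
    alexander_of_le hg (habs t) hx
  have hcont : Continuous fun p : M × I => chartExtend ψ (alexander g (1 - (p.2 : ℝ))) p.1 := by
    refine continuous_chartExtend (T := I) (A := fun t => alexander g (1 - (t : ℝ))) hψ ?_ hR
    exact (continuous_alexander g.continuous hδ).comp
      (continuous_fst.prodMk (continuous_const.sub (continuous_subtype_val.comp continuous_snd)))
  refine ⟨⟨_, H.continuous.comp (hcont.prodMk continuous_snd)⟩, fun x => ?_, fun x => ?_,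
    fun t => ?_⟩
  · have : alexander (g : E → E) 1 = g := funext (alexander_one g)
    simp [H0, chartExtendHomeo_apply, this]
  · have : alexander (g : E → E) 0 = id := funext (alexander_zero g)
    simp [H1, this, chartExtend_eq_self hψ.injective (A := id) (m := x)]
  · obtain ⟨e, he⟩ := He t
    exact ⟨(chartExtendHomeo hψ (alexanderHomeo g hδ (1 - t)) (hR t)).trans e, fun x => he _⟩

end Isotopy

section Reduction

variable {M : Type*} [MetricSpace M]

/-- Every homeomorphism of `M` which is sufficiently close to the identity and fixes `V`
pointwise can be changed by an isotopy to one which is close to the identity and fixes `W`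
pointwise. -/
def Reduces (V W : Set M) : Prop :=
  ∀ δ > 0, ∃ ε > 0, ∀ h : M ≃ₜ M, (∀ x, dist (h x) x < ε) → (∀ x ∈ V, h x = x) →
    ∃ h' : M ≃ₜ M, (∀ x, dist (h' x) x < δ) ∧ (∀ x ∈ W, h' x = x) ∧
      (IsotopicToId h' → IsotopicToId h)

lemma Reduces.refl (V : Set M) : Reduces V V :=
  fun δ hδ => ⟨δ, hδ, fun h hh hV => ⟨h, hh, hV, fun H => H⟩⟩

lemma Reduces.trans {U V W : Set M} (h₁ : Reduces U V) (h₂ : Reduces V W) : Reduces U W := by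
  intro δ hδ
  obtain ⟨ε₂, hε₂, H₂⟩ := h₂ δ hδ
  obtain ⟨ε₁, hε₁, H₁⟩ := h₁ ε₂ hε₂
  refine ⟨ε₁, hε₁, fun h hh hU => ?_⟩
  obtain ⟨h', hh', hV, hi'⟩ := H₁ h hh hU
  obtain ⟨h'', hh'', hW, hi''⟩ := H₂ h' hh' hV
  exact ⟨h'', hh'', hW, hi' ∘ hi''⟩

variable {E : Type*} [NormedAddCommGroup E] {ψ : E → M}

lemma exists_eq_of_dist_lt (hψ : IsOpenEmbedding ψ) {P : Set E} (hP : IsCompact P) {ε : ℝ}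
    (hε : 0 < ε) :
    ∃ η > 0, ∀ x ∈ P, ∀ m, dist m (ψ x) < η → ∃ y, ψ y = m ∧ ‖y - x‖ ≤ ε := by
  refine hP.induction_on (p := fun P => ∃ η > 0, ∀ x ∈ P, ∀ m, dist m (ψ x) < η →
    ∃ y, ψ y = m ∧ ‖y - x‖ ≤ ε) ⟨1, one_pos, by simp⟩ ?_ ?_ ?_
  · rintro s t hst ⟨η, hη, H⟩
    exact ⟨η, hη, fun x hx => H x (hst hx)⟩
  · rintro s t ⟨η, hη, H⟩ ⟨η', hη', H'⟩
    refine ⟨min η η', by positivity, fun x hx m hm => ?_⟩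
    rcases hx with hx | hx
    · exact H x hx m (hm.trans_le (min_le_left _ _))
    · exact H' x hx m (hm.trans_le (min_le_right _ _))
  · intro x _
    have h1 : ψ '' ball x (ε / 2) ∈ 𝓝 (ψ x) :=
      (hψ.isOpenMap _ isOpen_ball).mem_nhds ⟨x, mem_ball_self (by positivity), rfl⟩
    obtain ⟨r, hr, hsub⟩ := Metric.mem_nhds_iff.1 h1
    refine ⟨ball x (ε / 2) ∩ ψ ⁻¹' ball (ψ x) (r / 2), mem_nhdsWithin_of_mem_nhds
      (inter_mem (ball_mem_nhds _ (by positivity))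
        (hψ.continuous.continuousAt (ball_mem_nhds _ (by positivity)))),
      r / 2, by positivity, fun y hy m hm => ?_⟩
    have h2 : m ∈ ball (ψ x) r := by
      have := mem_ball.1 hy.2
      have := dist_triangle m (ψ y) (ψ x)
      rw [mem_ball]; linarith
    obtain ⟨z, hz, rfl⟩ := hsub h2
    refine ⟨z, rfl, ?_⟩
    have h3 := mem_ball.1 hz
    have h4 := mem_ball'.1 hy.1
    rw [← dist_eq_norm]
    linarith [dist_triangle z x y]

end Reduction

section ChartReduction

variable {M : Type*} [MetricSpace M] {ι : Type*} [Fintype ι]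

open Classical in
/-- The homeomorphism `h` read in the chart `ψ`, replaced by the identity at the points with a
coordinate in `K` of absolute value at least `1`. -/
noncomputable def readInChart (ψ : (ι → ℝ) → M) (K : Finset ι) (h : M → M) (x : ι → ℝ) : ι → ℝ :=
  if x ∈ slab K 1 then Function.invFun ψ (h (ψ x)) else x

lemma isNearEmbedding_readInChart [DecidableEq ι] {ψ : (ι → ℝ) → M} (hψ : IsOpenEmbedding ψ)
    (K : Finset ι) {a b r ε : ℝ} (ha : a < 1) (hb : 1 < b) (hε : ε < 1 - a) (hε0 : 0 ≤ ε)
    {h : M ≃ₜ M} (hh : ∀ x ∈ slab K b ∩ slab Kᶜ r, ∃ y, ψ y = h (ψ x) ∧ ‖y - x‖ ≤ ε)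
    (hfix : ∀ x ∈ slab K b ∩ slab Kᶜ r, (∃ k ∈ K, a ≤ |x k|) → h (ψ x) = ψ x) :
    IsNearEmbedding (readInChart ψ K h) (slab Kᶜ r) ε := by
  have hinv : ∀ y, Function.invFun ψ (ψ y) = y := Function.leftInverse_invFun hψ.injective
  have hsub : slab K 1 ⊆ slab K b := fun x hx k hk => (hx k hk).trans hb
  have hmem : ∀ x ∉ slab K 1, ∃ k ∈ K, 1 ≤ |x k| := fun x hx => by
    simpa [slab] using hx
  have hread : ∀ x ∈ slab K b ∩ slab Kᶜ r, ψ (readInChart ψ K h x) = h (ψ x) := by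
    intro x hx
    by_cases hx1 : x ∈ slab K 1
    · obtain ⟨y, hy, -⟩ := hh x hx
      rw [readInChart, if_pos hx1, ← hy, hinv]
    · obtain ⟨k, hk, hk1⟩ := hmem x hx1
      rw [readInChart, if_neg hx1, hfix x hx ⟨k, hk, by linarith⟩]
  have hnorm : ∀ x ∈ slab Kᶜ r, ‖readInChart ψ K h x - x‖ ≤ ε := by
    intro x hx
    by_cases hx1 : x ∈ slab K 1
    · obtain ⟨y, hy, hyε⟩ := hh x ⟨hsub hx1, hx⟩
      rw [readInChart, if_pos hx1, ← hy, hinv]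
      exact hyε
    · rw [readInChart, if_neg hx1, sub_self, norm_zero]; exact hε0
  have hne : ∀ x ∈ slab Kᶜ r, x ∈ slab K 1 → readInChart ψ K h x ∈ slab K 1 := by
    intro x hx hx1
    by_cases hxa : ∃ k ∈ K, a ≤ |x k|
    · rwa [hψ.injective ((hread x ⟨hsub hx1, hx⟩).trans (hfix x ⟨hsub hx1, hx⟩ hxa))]
    · push Not at hxa
      exact mem_slab_of_norm_sub_le (fun k hk => hxa k hk) (hnorm x hx) (by linarith)
  refine ⟨isLocalHomeomorphOn_of_locally_eqOn fun x hx => ?_, fun x hx y hy hxy => ?_, hnorm⟩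
  · by_cases hxb : x ∈ slab K b
    · let e := hψ.toOpenPartialHomeomorph ψ
      refine ⟨(e.trans h.toOpenPartialHomeomorph).trans e.symm, slab K b ∩ slab Kᶜ r,
        (isOpen_slab _ _).inter (isOpen_slab _ _), ⟨hxb, hx⟩, ?_, ?_⟩
      · intro y hy
        refine ⟨(e.trans h.toOpenPartialHomeomorph).trans e.symm, ?_, rfl⟩
        obtain ⟨z, hz, -⟩ := hh y hy
        simpa [e] using ⟨z, hz⟩
      · intro y hy
        have : e (readInChart ψ K h y) = h (ψ y) := hread y hy
        change _ = e.symm (h (ψ y))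
        rw [← this, e.left_inv]
        simp [e]
    · have : ∃ k ∈ K, b ≤ |x k| := by simpa [slab] using hxb
      obtain ⟨k, hk, hkb⟩ := this
      refine ⟨id, {y | 1 < |y k|}, isOpen_lt continuous_const (by fun_prop), hb.trans_le hkb,
        (Homeomorph.refl _).isLocalHomeomorph.isLocalHomeomorphOn.mono (subset_univ _), ?_⟩
      intro y hy
      exact if_neg fun hy1 => (hy1 k hk).not_gt hy
  · by_cases hx1 : x ∈ slab K 1 <;> by_cases hy1 : y ∈ slab K 1
    · refine hψ.injective (h.injective ?_)
      rw [← hread x ⟨hsub hx1, hx⟩, ← hread y ⟨hsub hy1, hy⟩, hxy]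
    · have := hne x hx hx1
      rw [hxy, readInChart, if_neg hy1] at this
      exact absurd this hy1
    · have := hne y hy hy1
      rw [← hxy, readInChart, if_neg hx1] at this
      exact absurd this hx1
    · rwa [readInChart, if_neg hx1, readInChart, if_neg hy1] at hxy

lemma reduces_box [DecidableEq ι] {ψ : (ι → ℝ) → M} (hψ : IsOpenEmbedding ψ) (K : Finset ι)
    {a b : ℝ} (ha : a < 1) (hb : 1 < b) {V : Set M}
    (hV : ∀ x ∈ slab K b ∩ slab Kᶜ (20 + Kᶜ.card), (∃ k ∈ K, a ≤ |x k|) → ψ x ∈ V) :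
    Reduces V ((V \ ψ '' {x | ‖x‖ ≤ 4 ∧ ∀ k ∈ K, |x k| ≤ 1}) ∪
      ψ '' (slab K b ∩ slab Kᶜ (1 / 2))) := by
  intro δ hδ
  obtain ⟨δ', hδ', hunif⟩ := Metric.uniformContinuousOn_iff.1
    ((isCompact_closedBall (0 : ι → ℝ) 4).uniformContinuousOn_of_continuous
      hψ.continuous.continuousOn) (δ / 2) (by positivity)
  obtain ⟨ε₀, hε₀, H⟩ := exists_homeomorph_eqOn_ball K (δ := min (δ' / 2) (1 / 4)) (by positivity)
  set r : ℝ := 20 + Kᶜ.card with hr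
  have hr20 : 20 ≤ r := by rw [hr]; linarith [(Nat.cast_nonneg Kᶜ.card : (0 : ℝ) ≤ Kᶜ.card)]
  obtain ⟨η, hη, hU⟩ := exists_eq_of_dist_lt hψ (isCompact_closedBall 0 (b + r))
    (ε := min ε₀ ((1 - a) / 2)) (lt_min hε₀ (by linarith))
  refine ⟨min η (δ / 2), by positivity, fun h hh hhV => ?_⟩
  have hball : ∀ x ∈ slab K b ∩ slab Kᶜ r, x ∈ closedBall 0 (b + r) := by
    intro x hx
    rw [mem_closedBall_zero_iff, pi_norm_le_iff_of_nonneg (by linarith)]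
    intro i
    rw [Real.norm_eq_abs]
    by_cases hi : i ∈ K
    · linarith [hx.1 i hi]
    · linarith [hx.2 i (Finset.mem_compl.2 hi)]
  have hlift : ∀ x ∈ slab K b ∩ slab Kᶜ r, ∃ y, ψ y = h (ψ x) ∧ ‖y - x‖ ≤ min ε₀ ((1 - a) / 2) :=
    fun x hx => hU x (hball x hx) _ ((hh _).trans_le (min_le_left _ _))
  have hf := isNearEmbedding_readInChart hψ K ha hb
    ((min_le_right _ _).trans_lt (by linarith)) (le_min hε₀.le (by linarith)) hlift
    fun x hx hxk => hhV _ (hV x hx hxk)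
  obtain ⟨g, hgδ, hg4, hgK, hgf⟩ := H (readInChart ψ K h)
    ⟨hf.isLocalHomeomorphOn, hf.injOn, fun x hx => (hf.norm_sub_le x hx).trans (min_le_left _ _)⟩
    fun x _ ⟨k, hk, hxk⟩ => if_neg fun hx => (hx k hk).not_ge hxk
  have hs4 : ∀ x, 4 ≤ ‖x‖ → g.symm x = x := fun x hx => g.symm_apply_eq.2 (hg4 x hx).symm
  have hsK : ∀ x, (∃ k ∈ K, 1 ≤ |x k|) → g.symm x = x := fun x hx =>
    g.symm_apply_eq.2 (hgK x hx).symm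
  have hsδ : ∀ x, ‖g.symm x - x‖ ≤ min (δ' / 2) (1 / 4) := fun x => by
    have := hgδ (g.symm x)
    rwa [g.apply_symm_apply, norm_sub_rev] at this
  refine ⟨(chartExtendHomeo hψ g hg4).symm.trans h, fun m => ?_, fun m hm => ?_, fun hi => ?_⟩
  · have h1 : dist ((chartExtendHomeo hψ g hg4).symm m) m < δ / 2 := by
      rw [chartExtendHomeo_symm_apply]
      by_cases hm : m ∈ range ψ
      · obtain ⟨x, rfl⟩ := hm
        rw [chartExtend_apply hψ.injective]
        by_cases hx : 4 ≤ ‖x‖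
        · rw [hs4 x hx, dist_self]; positivity
        · refine hunif _ ?_ _ (by simpa using (not_le.1 hx).le) ?_
          · rw [mem_closedBall_zero_iff]
            by_contra hlt
            have := hg4 _ (not_le.1 hlt).le
            rw [g.apply_symm_apply] at this
            exact hx (this ▸ (not_le.1 hlt).le)
          · rw [dist_eq_norm]
            linarith [(hsδ x).trans (min_le_left _ _)]
      · rw [chartExtend_of_notMem_range ψ _ hm, dist_self]; positivity
    have h2 := (hh ((chartExtendHomeo hψ g hg4).symm m)).trans_le (min_le_right _ _)
    rw [Homeomorph.trans_apply]
    linarith [dist_triangle (h ((chartExtendHomeo hψ g hg4).symm m))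
      ((chartExtendHomeo hψ g hg4).symm m) m]
  · rw [Homeomorph.trans_apply, chartExtendHomeo_symm_apply]
    rcases hm with ⟨hmV, hmB⟩ | ⟨x, ⟨hxb, hx⟩, rfl⟩
    · rw [chartExtend_eq_self hψ.injective, hhV m hmV]
      rintro x rfl
      by_contra hne
      refine hmB ⟨x, ⟨?_, fun k hk => ?_⟩, rfl⟩
      · by_contra hlt
        exact hne (hs4 x (not_le.1 hlt).le)
      · by_contra hlt
        exact hne (hsK x ⟨k, hk, (not_le.1 hlt).le⟩)
    · rw [chartExtend_apply hψ.injective]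
      by_cases hx1 : ∃ k ∈ K, 1 ≤ |x k|
      · rw [hsK x hx1]
        obtain ⟨k, hk, hk1⟩ := hx1
        exact hhV _ (hV x ⟨hxb, fun j hj => (hx j hj).trans (by linarith)⟩
          ⟨k, hk, by linarith⟩)
      · have hy1 : ∀ k ∈ K, |g.symm x k| < 1 := by
          by_contra! hy
          have := hgK _ hy
          rw [g.apply_symm_apply] at this
          exact hx1 (this ▸ hy)
        have hyn : ‖g.symm x‖ < 1 := by
          rw [pi_norm_lt_iff one_pos]
          intro i
          by_cases hi : i ∈ K
          · exact hy1 i hi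
          · exact mem_slab_of_norm_sub_le hx ((hsδ x).trans (min_le_right _ _))
              (by norm_num : (1 / 2 + 1 / 4 : ℝ) ≤ 1) i (Finset.mem_compl.2 hi)
        have h3 := hgf _ hyn
        rw [g.apply_symm_apply, readInChart, if_pos (show g.symm x ∈ slab K 1 from hy1)] at h3
        obtain ⟨z, hz, -⟩ := hlift (g.symm x) ⟨fun k hk => (hy1 k hk).trans hb,
          fun j _ => ((norm_le_pi_norm _ j).trans_lt hyn).trans_le (by linarith)⟩
        rw [← hz, Function.leftInverse_invFun hψ.injective] at h3
        rw [← hz, ← h3]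
  · have := hi.chartExtend_trans hψ hg4 hgδ
    convert this using 1
    ext m
    simp

end ChartReduction

section Face

variable {M : Type*} [MetricSpace M] {ι : Type*} [DecidableEq ι]

/-- The face of the unit cube at `v` spanned by the coordinate directions in `K`. -/
def cubeFace (v : ι → ℝ) (K : Finset ι) : Set (ι → ℝ) :=
  Icc v fun i => if i ∈ K then v i + 1 else v i

lemma mem_cubeFace {v x : ι → ℝ} {K : Finset ι} :
    x ∈ cubeFace v K ↔ (∀ k ∈ K, v k ≤ x k ∧ x k ≤ v k + 1) ∧ ∀ j ∉ K, x j = v j := by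
  simp only [cubeFace, mem_Icc, Pi.le_def, ← forall_and]
  refine forall_congr' fun i => ?_
  by_cases hi : i ∈ K
  · simp [hi]
  · simp [hi, le_antisymm_iff, and_comm]

lemma isCompact_cubeFace (v : ι → ℝ) (K : Finset ι) : IsCompact (cubeFace v K) := isCompact_Icc

/-- The points of a face on its relative boundary. -/
def cubeFaceBoundary (v : ι → ℝ) (K : Finset ι) : Set (ι → ℝ) :=
  cubeFace v K ∩ {x | ∃ k ∈ K, x k = v k ∨ x k = v k + 1}

lemma isCompact_cubeFaceBoundary (v : ι → ℝ) (K : Finset ι) :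
    IsCompact (cubeFaceBoundary v K) := by
  refine (isCompact_cubeFace v K).inter_right ?_
  have : {x : ι → ℝ | ∃ k ∈ K, x k = v k ∨ x k = v k + 1} =
      ⋃ k ∈ K, {x | x k = v k ∨ x k = v k + 1} := by ext; simp
  rw [this]
  refine K.finite_toSet.isClosed_biUnion fun k _ => ?_
  exact (isClosed_eq (continuous_apply k) continuous_const).union
    (isClosed_eq (continuous_apply k) continuous_const)

/-- The affine homeomorphism taking a standard handle to a neighbourhood of a face. -/
noncomputable def faceHomeo (v : ι → ℝ) (K : Finset ι) {c η : ℝ} (hc : 0 < c) (hη : 0 < η) :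
    (ι → ℝ) ≃ₜ (ι → ℝ) :=
  Homeomorph.piCongrRight fun i => affineHomeomorph (if i ∈ K then c / 2 else η)
    (if i ∈ K then v i + 1 / 2 else v i) (by split_ifs <;> positivity)

lemma faceHomeo_apply_of_mem (v : ι → ℝ) {K : Finset ι} {c η : ℝ} (hc : 0 < c) (hη : 0 < η)
    (x : ι → ℝ) {k : ι} (hk : k ∈ K) : faceHomeo v K hc hη x k = v k + 1 / 2 + c / 2 * x k := by
  simp [faceHomeo, hk, add_comm]

lemma faceHomeo_apply_of_notMem (v : ι → ℝ) {K : Finset ι} {c η : ℝ} (hc : 0 < c) (hη : 0 < η)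
    (x : ι → ℝ) {j : ι} (hj : j ∉ K) : faceHomeo v K hc hη x j = v j + η * x j := by
  simp [faceHomeo, hj, add_comm]

variable [Fintype ι]

/-- A small handle lies near the boundary of the face away from the core. -/
lemma faceHomeo_mem_thickening {v : ι → ℝ} {K : Finset ι} {κ η r δ : ℝ} (hκ : 0 < κ)
    (hκ1 : κ < 1 / 2) (hη : 0 < η) (hκδ : κ < δ) (hηδ : η * r ≤ κ) {x : ι → ℝ}
    (hx : x ∈ slab K (1 + 2 * κ) ∩ slab Kᶜ r) (hxk : ∃ k ∈ K, 1 - κ ≤ |x k|) :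
    faceHomeo v K (sub_pos.2 (by linarith : κ < 1)) hη x ∈
      thickening δ (cubeFaceBoundary v K) := by
  obtain ⟨k₀, hk₀, hk₀x⟩ := hxk
  set y := faceHomeo v K (sub_pos.2 (by linarith : κ < 1)) hη x with hy
  have hyk : ∀ k ∈ K, v k - κ / 2 ≤ y k ∧ y k ≤ v k + 1 + κ / 2 := by
    intro k hk
    rw [hy, faceHomeo_apply_of_mem v _ hη x hk]
    have := abs_lt.1 (hx.1 k hk)
    constructor <;> nlinarith
  have hy0 : |y k₀ - (if 0 ≤ x k₀ then v k₀ + 1 else v k₀)| ≤ κ := by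
    have h1 := hyk k₀ hk₀
    have h2 : y k₀ = v k₀ + 1 / 2 + (1 - κ) / 2 * x k₀ := by
      rw [hy, faceHomeo_apply_of_mem v _ hη x hk₀]
    rw [abs_le]
    split_ifs with h
    · rw [abs_of_nonneg h] at hk₀x
      constructor <;> nlinarith
    · rw [abs_of_neg (not_le.1 h)] at hk₀x
      constructor <;> nlinarith
  refine mem_thickening_iff.2 ⟨fun i => if i = k₀ then (if 0 ≤ x i then v i + 1 else v i) else
    if i ∈ K then max (v i) (min (y i) (v i + 1)) else v i, ⟨?_, k₀, hk₀, ?_⟩, ?_⟩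
  · refine mem_cubeFace.2 ⟨fun k hk => ?_, fun j hj => ?_⟩
    · by_cases h : k = k₀
      · simp only [h, if_true]; split_ifs <;> constructor <;> linarith
      · simp [h, hk]
    · have h : j ≠ k₀ := fun h => hj (h ▸ hk₀)
      simp [h, hj]
  · simp only [if_true]
    split_ifs <;> simp
  · refine lt_of_le_of_lt ((dist_pi_le_iff hκ.le).2 fun i => ?_) hκδ
    rw [Real.dist_eq]
    by_cases h : i = k₀
    · simpa [h] using hy0
    · by_cases hi : i ∈ K
      · have := hyk i hi
        simp only [h, hi, if_true, if_false]
        rw [abs_le]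
        simp only [max_def, min_def]
        split_ifs <;> constructor <;> linarith
      · simp only [h, hi, if_false]
        rw [hy, faceHomeo_apply_of_notMem v _ hη x hi, add_sub_cancel_left, abs_mul,
          abs_of_pos hη]
        exact (mul_le_mul_of_nonneg_left (hx.2 i (Finset.mem_compl.2 hi)).le hη.le).trans hηδ

lemma reduces_cubeFace {ψ : (ι → ℝ) → M} (hψ : IsOpenEmbedding ψ) (v : ι → ℝ) (K : Finset ι)
    {C V : Set M} (hC : IsClosed C) (hV : IsOpen V) (hCV : C ⊆ V)
    (hbd : ∀ x ∈ cubeFaceBoundary v K, ψ x ∈ V)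
    (hint : ∀ x ∈ cubeFace v K, ψ x ∈ C → x ∈ cubeFaceBoundary v K) :
    ∃ W, IsOpen W ∧ C ∪ ψ '' cubeFace v K ⊆ W ∧ Reduces V W := by
  obtain ⟨δ, hδ, hδV⟩ := (isCompact_cubeFaceBoundary v K).exists_thickening_subset_open
    (hV.preimage hψ.continuous) hbd
  obtain ⟨κ, hκ, hκ'⟩ := exists_between (show 0 < min δ (1 / 2) by positivity)
  have hκδ : κ < δ := hκ'.trans_le (min_le_left _ _)
  have hκ1 : κ < 1 / 2 := hκ'.trans_le (min_le_right _ _)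
  have hcore : Icc (fun i => if i ∈ K then v i + κ / 2 else v i)
      (fun i => if i ∈ K then v i + 1 - κ / 2 else v i) ⊆ ψ ⁻¹' Cᶜ := by
    intro x hx hxC
    have hx1 : ∀ k ∈ K, v k + κ / 2 ≤ x k ∧ x k ≤ v k + 1 - κ / 2 := fun k hk => by
      simpa [hk] using And.intro (hx.1 k) (hx.2 k)
    have hx2 : ∀ j ∉ K, x j = v j := fun j hj => by
      have h1 := hx.1 j
      have h2 := hx.2 j
      simp only [hj, if_false] at h1 h2
      exact le_antisymm h2 h1
    obtain ⟨-, k, hk, h⟩ := hint x (mem_cubeFace.2 ⟨fun k hk => by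
      constructor <;> linarith [hx1 k hk], hx2⟩) hxC
    have := hx1 k hk
    rcases h with h | h <;> linarith
  obtain ⟨η', hη', hηC⟩ := isCompact_Icc.exists_thickening_subset_open
    (hC.isOpen_compl.preimage hψ.continuous) hcore
  set r : ℝ := 20 + Kᶜ.card with hr
  have hr20 : 20 ≤ r := by rw [hr]; linarith [(Nat.cast_nonneg Kᶜ.card : (0 : ℝ) ≤ Kᶜ.card)]
  obtain ⟨η, hη, hηr, hη4⟩ : ∃ η > 0, η * r ≤ κ ∧ η * 4 < η' := by
    refine ⟨min (κ / r) (η' / 8), by positivity, ?_, ?_⟩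
    · rw [← le_div_iff₀ (by linarith)]; exact min_le_left _ _
    · linarith [min_le_right (κ / r) (η' / 8)]
  let A := faceHomeo v K (sub_pos.2 (by linarith : κ < 1)) hη
  have hψA : IsOpenEmbedding (ψ ∘ A) := hψ.comp A.isOpenEmbedding
  have hred := reduces_box (V := V) hψA K (a := 1 - κ) (b := 1 + 2 * κ) (by linarith) (by linarith)
    fun x hx hxk => hδV (faceHomeo_mem_thickening hκ hκ1 hη hκδ hηr hx hxk)
  refine ⟨_, ?_, ?_, hred⟩
  · have hB : IsCompact {x : ι → ℝ | ‖x‖ ≤ 4 ∧ ∀ k ∈ K, |x k| ≤ 1} := by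
      refine (isCompact_closedBall (0 : ι → ℝ) 4).of_isClosed_subset ?_
        fun x hx => by simpa using hx.1
      simp only [ofPred_and, ofPred_forall]
      refine (isClosed_le continuous_norm continuous_const).inter
        (isClosed_biInter fun k _ => isClosed_le (by fun_prop) continuous_const)
    exact (hV.sdiff (hB.image hψA.continuous).isClosed).union
      (hψA.isOpenMap _ ((isOpen_slab _ _).inter (isOpen_slab _ _)))
  · rintro m (hm | ⟨x, hx, rfl⟩)
    · refine Or.inl ⟨hCV hm, ?_⟩
      rintro ⟨x, ⟨hx4, hx1⟩, rfl⟩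
      refine hηC (?_ : A x ∈ _) hm
      refine mem_thickening_iff.2 ⟨fun i => if i ∈ K then A x i else v i,
        ⟨fun i => ?_, fun i => ?_⟩, ?_⟩
      · by_cases hi : i ∈ K
        · have := abs_le.1 (hx1 i hi)
          simp only [hi, if_true, A, faceHomeo_apply_of_mem v _ hη x hi]
          nlinarith
        · simp [hi]
      · by_cases hi : i ∈ K
        · have := abs_le.1 (hx1 i hi)
          simp only [hi, if_true, A, faceHomeo_apply_of_mem v _ hη x hi]
          nlinarith
        · simp [hi]
      · refine lt_of_le_of_lt ((dist_pi_le_iff (by positivity)).2 fun i => ?_) hη4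
        by_cases hi : i ∈ K
        · simp only [hi, if_true, dist_self]; positivity
        · simp only [hi, if_false, A, faceHomeo_apply_of_notMem v _ hη x hi]
          rw [Real.dist_eq, add_sub_cancel_left, abs_mul, abs_of_pos hη]
          exact mul_le_mul_of_nonneg_left ((norm_le_pi_norm x i).trans hx4) hη.le
    · obtain ⟨y, rfl⟩ := A.surjective x
      refine Or.inr ⟨y, ⟨fun k hk => ?_, fun j hj => ?_⟩, rfl⟩
      · have h1 := (mem_cubeFace.1 hx).1 k hk
        simp only [A, faceHomeo_apply_of_mem v _ hη y hk] at h1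
        rw [abs_lt]
        constructor <;> by_contra! h <;> nlinarith
      · have hj' := Finset.mem_compl.1 hj
        have h1 := (mem_cubeFace.1 hx).2 j hj'
        simp only [A, faceHomeo_apply_of_notMem v _ hη y hj', add_eq_left, mul_eq_zero,
          hη.ne', false_or] at h1
        rw [h1]; norm_num

end Face

section Lattice

variable {M : Type*} [MetricSpace M] {ι : Type*} [DecidableEq ι]

/-- The face of the integer lattice at `c.1` spanned by the directions in `c.2`. -/
def latticeFace (c : (ι → ℤ) × Finset ι) : Set (ι → ℝ) := cubeFace (fun i => (c.1 i : ℝ)) c.2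

lemma mem_latticeFace {c : (ι → ℤ) × Finset ι} {x : ι → ℝ} :
    x ∈ latticeFace c ↔
      (∀ k ∈ c.2, (c.1 k : ℝ) ≤ x k ∧ x k ≤ c.1 k + 1) ∧ ∀ j ∉ c.2, x j = c.1 j :=
  mem_cubeFace

lemma exists_facet_of_mem_boundary {v : ι → ℤ} {K : Finset ι} {x : ι → ℝ}
    (hx : x ∈ cubeFaceBoundary (fun i => (v i : ℝ)) K) :
    ∃ k ∈ K, x ∈ latticeFace (v, K.erase k) ∨
      x ∈ latticeFace (Function.update v k (v k + 1), K.erase k) := by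
  obtain ⟨hx, k, hk, h⟩ := hx
  rw [mem_cubeFace] at hx
  refine ⟨k, hk, h.imp (fun h => ?_) fun h => ?_⟩ <;> rw [mem_latticeFace] <;>
    refine ⟨fun i hi => ?_, fun j hj => ?_⟩
  · exact hx.1 i (Finset.mem_of_mem_erase hi)
  · by_cases hjk : j = k
    · exact hjk ▸ h
    · exact hx.2 j fun hj' => hj (Finset.mem_erase.2 ⟨hjk, hj'⟩)
  · have hik : i ≠ k := (Finset.mem_erase.1 hi).1
    simpa [hik] using hx.1 i (Finset.mem_of_mem_erase hi)
  · by_cases hjk : j = k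
    · subst hjk; simpa using h
    · simpa [hjk] using hx.2 j fun hjK => hj (Finset.mem_erase.2 ⟨hjk, hjK⟩)

/-- A face meeting the relative interior of another face contains it. -/
lemma subset_of_mem_interior {c c' : (ι → ℤ) × Finset ι} {x : ι → ℝ} (hx : x ∈ latticeFace c)
    (hxb : x ∉ cubeFaceBoundary (fun i => (c.1 i : ℝ)) c.2) (hx' : x ∈ latticeFace c') :
    c.2 ⊆ c'.2 ∧ (∀ k ∈ c.2, c.1 k = c'.1 k) ∧ latticeFace c ⊆ latticeFace c' := by
  have hint : ∀ k ∈ c.2, (c.1 k : ℝ) < x k ∧ x k < c.1 k + 1 := by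
    intro k hk
    have h1 := (mem_latticeFace.1 hx).1 k hk
    refine ⟨lt_of_le_of_ne h1.1 fun h => hxb ⟨hx, k, hk, Or.inl h.symm⟩,
      lt_of_le_of_ne h1.2 fun h => hxb ⟨hx, k, hk, Or.inr h⟩⟩
  have hK : c.2 ⊆ c'.2 := by
    intro k hk
    by_contra hk'
    have h1 := (mem_latticeFace.1 hx').2 k hk'
    have h2 := hint k hk
    rw [h1] at h2
    have h3 : c.1 k < c'.1 k := by exact_mod_cast h2.1
    have h4 : c'.1 k < c.1 k + 1 := by exact_mod_cast h2.2
    omega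
  have hv : ∀ k ∈ c.2, c.1 k = c'.1 k := by
    intro k hk
    have h1 := (mem_latticeFace.1 hx').1 k (hK hk)
    have h2 := hint k hk
    have h3 : (c.1 k : ℝ) < c'.1 k + 1 := by linarith
    have h4 : (c'.1 k : ℝ) < c.1 k + 1 := by linarith
    have h3' : c.1 k < c'.1 k + 1 := by exact_mod_cast h3
    have h4' : c'.1 k < c.1 k + 1 := by exact_mod_cast h4
    omega
  refine ⟨hK, hv, fun y hy => mem_latticeFace.2 ⟨fun k hk => ?_, fun j hj => ?_⟩⟩
  · by_cases hkc : k ∈ c.2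
    · rw [← hv k hkc]; exact (mem_latticeFace.1 hy).1 k hkc
    · rw [(mem_latticeFace.1 hy).2 k hkc, ← (mem_latticeFace.1 hx).2 k hkc]
      exact (mem_latticeFace.1 hx').1 k hk
  · have hjc : j ∉ c.2 := fun h => hj (hK h)
    rw [(mem_latticeFace.1 hy).2 j hjc, ← (mem_latticeFace.1 hx).2 j hjc]
    exact (mem_latticeFace.1 hx').2 j hj

variable [Fintype ι]

lemma reduces_iUnion_latticeFace {ψ : (ι → ℝ) → M} (hψ : IsOpenEmbedding ψ) {C V : Set M}
    (hC : IsClosed C) (hV : IsOpen V) (hCV : C ⊆ V) (S : Finset ((ι → ℤ) × Finset ι))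
    (hmesh : ∀ c ∈ S, ∀ x ∈ latticeFace c, ψ x ∈ C → ψ '' latticeFace c ⊆ V)
    (hdown : ∀ c ∈ S, ∀ k ∈ c.2, ψ '' latticeFace c ⊆ V ∨
      (c.1, c.2.erase k) ∈ S ∧ (Function.update c.1 k (c.1 k + 1), c.2.erase k) ∈ S) :
    ∃ W, IsOpen W ∧ C ∪ ⋃ c ∈ S, ψ '' latticeFace c ⊆ W ∧ Reduces V W := by
  induction S using Finset.strongInduction with
  | H S ih =>
    by_cases hgood : ∀ c ∈ S, ψ '' latticeFace c ⊆ V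
    · exact ⟨V, hV, union_subset hCV (iUnion₂_subset hgood), Reduces.refl V⟩
    push Not at hgood
    obtain ⟨c₀, hc₀, hc₀V⟩ := hgood
    classical
    obtain ⟨c, hc, hmax⟩ := Finset.exists_max_image
      (S.filter fun c => ¬ ψ '' latticeFace c ⊆ V) (fun c => c.2.card)
      ⟨c₀, Finset.mem_filter.2 ⟨hc₀, hc₀V⟩⟩
    obtain ⟨hcS, hcV⟩ := Finset.mem_filter.1 hc
    have hcard : ∀ c' ∈ S, ¬ ψ '' latticeFace c' ⊆ V → c'.2.card ≤ c.2.card := fun c' h h' =>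
      hmax c' (Finset.mem_filter.2 ⟨h, h'⟩)
    obtain ⟨W₁, hW₁, hCW₁, hred₁⟩ := ih (S.erase c) (Finset.erase_ssubset hcS)
      (fun c' hc' => hmesh c' (Finset.mem_of_mem_erase hc')) (by
        intro c' hc' k hk
        have hc'S := Finset.mem_of_mem_erase hc'
        refine or_iff_not_imp_left.2 fun hbad => ?_
        have h1 := (hdown c' hc'S k hk).resolve_left hbad
        have h2 : c'.2.erase k ≠ c.2 := fun h => by
          have := Finset.card_erase_lt_of_mem hk
          rw [h] at this
          exact (hcard c' hc'S hbad).not_gt this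
        exact ⟨Finset.mem_erase.2 ⟨fun h => h2 (congrArg Prod.snd h), h1.1⟩,
          Finset.mem_erase.2 ⟨fun h => h2 (congrArg Prod.snd h), h1.2⟩⟩)
    have hclosed : IsClosed (C ∪ ⋃ c' ∈ S.erase c, ψ '' latticeFace c') :=
      hC.union ((S.erase c).finite_toSet.isClosed_biUnion fun c' _ =>
        ((isCompact_cubeFace _ _).image hψ.continuous).isClosed)
    obtain ⟨W, hW, hCW, hred⟩ := reduces_cubeFace hψ (fun i => (c.1 i : ℝ)) c.2 hclosed hW₁ hCW₁
      (by
        intro x hx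
        obtain ⟨k, hk, h⟩ := exists_facet_of_mem_boundary hx
        have h1 := (hdown c hcS k hk).resolve_left hcV
        have h2 : c.2.erase k ≠ c.2 := fun h => by
          have := Finset.card_erase_lt_of_mem hk
          rw [h] at this
          exact this.false
        refine hCW₁ (Or.inr ?_)
        simp only [mem_iUnion₂]
        rcases h with h | h
        · exact ⟨_, Finset.mem_erase.2 ⟨fun h => h2 (congrArg Prod.snd h), h1.1⟩, x, h, rfl⟩
        · exact ⟨_, Finset.mem_erase.2 ⟨fun h => h2 (congrArg Prod.snd h), h1.2⟩, x, h, rfl⟩)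
      (by
        intro x hx hxC
        by_contra hxb
        rcases hxC with hxC | hxC
        · exact hcV (hmesh c hcS x hx hxC)
        · simp only [mem_iUnion₂] at hxC
          obtain ⟨c', hc', y, hy, hyx⟩ := hxC
          obtain rfl := hψ.injective hyx
          obtain ⟨hK, hv, hsub⟩ := subset_of_mem_interior hx hxb hy
          have hc'V : ¬ ψ '' latticeFace c' ⊆ V := fun h => hcV ((image_mono hsub).trans h)
          obtain ⟨hne, hc'S⟩ := Finset.mem_erase.1 hc'
          have hKe := Finset.eq_of_subset_of_card_le hK (hcard c' hc'S hc'V)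
          refine hne (Prod.ext (funext fun i => ?_) hKe.symm)
          by_cases hi : i ∈ c.2
          · exact (hv i hi).symm
          · have h1 := (mem_latticeFace.1 hx).2 i hi
            have h2 := (mem_latticeFace.1 hy).2 i (hKe ▸ hi)
            exact_mod_cast h2.symm.trans h1)
    refine ⟨W, hW, ?_, hred₁.trans hred⟩
    rintro m (hm | hm)
    · exact hCW (Or.inl (Or.inl hm))
    · simp only [mem_iUnion₂] at hm
      obtain ⟨c', hc', hm⟩ := hm
      by_cases h : c' = c
      · exact hCW (Or.inr (h ▸ hm))
      · refine hCW (Or.inl (Or.inr ?_))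
        simp only [mem_iUnion₂]
        exact ⟨c', Finset.mem_erase.2 ⟨h, hc'⟩, hm⟩

end Lattice

section Absorbable

variable {M : Type*} [MetricSpace M]

/-- Homeomorphisms of `M` fixing a neighbourhood of a closed set `C` can be changed by an isotopy
so as to fix a neighbourhood of `C ∪ A` in addition. -/
def Absorbable (A : Set M) : Prop :=
  ∀ C V : Set M, IsClosed C → IsOpen V → C ⊆ V →
    ∃ D W : Set M, IsClosed D ∧ IsOpen W ∧ D ⊆ W ∧ C ∪ A ⊆ D ∧ Reduces V W

lemma Absorbable.mono {A A' : Set M} (h : Absorbable A) (hA : A' ⊆ A) : Absorbable A' := by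
  intro C V hC hV hCV
  obtain ⟨D, W, hD, hW, hDW, hCA, hred⟩ := h C V hC hV hCV
  exact ⟨D, W, hD, hW, hDW, (union_subset_union_right C hA).trans hCA, hred⟩

lemma Absorbable.union {A B : Set M} (hA : Absorbable A) (hB : Absorbable B) :
    Absorbable (A ∪ B) := by
  intro C V hC hV hCV
  obtain ⟨D, W, hD, hW, hDW, hCA, hred⟩ := hA C V hC hV hCV
  obtain ⟨D', W', hD', hW', hDW', hCA', hred'⟩ := hB D W hD hW hDW
  refine ⟨D', W', hD', hW', hDW', ?_, hred.trans hred'⟩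
  rw [← union_assoc]
  exact (union_subset_union_left B hCA).trans hCA'

lemma absorbable_empty : Absorbable (∅ : Set M) := fun C V hC hV hCV =>
  ⟨C, V, hC, hV, hCV, by simp, Reduces.refl V⟩

variable {ι : Type*} [Fintype ι]

lemma absorbable_image_ball {ψ : (ι → ℝ) → M} (hψ : IsOpenEmbedding ψ) :
    Absorbable (ψ '' ball 0 1) := by
  classical
  intro C V hC hV hCV
  obtain ⟨δ, hδ, hδV⟩ := ((isCompact_closedBall (0 : ι → ℝ) 1).inter_right
    (hC.preimage hψ.continuous)).exists_thickening_subset_open (hV.preimage hψ.continuous)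
    fun x hx => hCV hx.2
  obtain ⟨n, hn⟩ := exists_nat_one_div_lt hδ
  set N : ℕ := n + 1 with hNdef
  have hN : (0 : ℝ) < N := by positivity
  have hNδ : (N : ℝ)⁻¹ < δ := by simpa [hNdef] using hn
  let A : (ι → ℝ) ≃ₜ (ι → ℝ) := Homeomorph.smulOfNeZero (N : ℝ)⁻¹ (by positivity)
  have hψA : IsOpenEmbedding (ψ ∘ A) := hψ.comp A.isOpenEmbedding
  let S : Finset ((ι → ℤ) × Finset ι) :=
    ((Finset.Icc (fun _ => -(N : ℤ)) fun _ => (N : ℤ)) ×ˢ Finset.univ).filter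
      fun c => ∀ k ∈ c.2, c.1 k + 1 ≤ N
  have hS : ∀ c, c ∈ S ↔ (∀ i, -(N : ℤ) ≤ c.1 i ∧ c.1 i ≤ N) ∧ ∀ k ∈ c.2, c.1 k + 1 ≤ N := by
    intro c
    simp [S, Pi.le_def, forall_and]
  have hnorm : ∀ c ∈ S, ∀ x ∈ latticeFace c, ‖x‖ ≤ N := by
    intro c hc x hx
    obtain ⟨h1, h2⟩ := (hS c).1 hc
    rw [pi_norm_le_iff_of_nonneg hN.le]
    intro i
    have h3 : (-(N : ℝ)) ≤ c.1 i := by exact_mod_cast (h1 i).1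
    rw [Real.norm_eq_abs, abs_le]
    by_cases hi : i ∈ c.2
    · have h4 : (c.1 i : ℝ) + 1 ≤ N := by exact_mod_cast h2 i hi
      have h5 := (mem_latticeFace.1 hx).1 i hi
      constructor <;> linarith
    · have h4 : (c.1 i : ℝ) ≤ N := by exact_mod_cast (h1 i).2
      rw [(mem_latticeFace.1 hx).2 i hi]
      exact ⟨h3, h4⟩
  obtain ⟨W, hW, hCW, hred⟩ := reduces_iUnion_latticeFace hψA hC hV hCV S
    (by
      rintro c hc x hx hxC _ ⟨y, hy, rfl⟩
      refine hδV (?_ : A y ∈ _)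
      refine mem_thickening_iff.2 ⟨A x, ⟨?_, hxC⟩, ?_⟩
      · rw [mem_closedBall_zero_iff]
        change ‖(N : ℝ)⁻¹ • x‖ ≤ 1
        rw [norm_smul, norm_inv, Real.norm_of_nonneg hN.le, inv_mul_le_one₀ hN]
        exact hnorm c hc x hx
      · refine lt_of_le_of_lt ?_ hNδ
        change dist ((N : ℝ)⁻¹ • y) ((N : ℝ)⁻¹ • x) ≤ _
        rw [dist_smul₀, norm_inv, Real.norm_of_nonneg hN.le]
        refine mul_le_of_le_one_right (by positivity) ((dist_pi_le_iff zero_le_one).2 fun i => ?_)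
        rw [Real.dist_eq, abs_le]
        by_cases hi : i ∈ c.2
        · have h1 := (mem_latticeFace.1 hx).1 i hi
          have h2 := (mem_latticeFace.1 hy).1 i hi
          constructor <;> linarith
        · rw [(mem_latticeFace.1 hx).2 i hi, (mem_latticeFace.1 hy).2 i hi]
          simp)
    (by
      intro c hc k hk
      obtain ⟨h1, h2⟩ := (hS c).1 hc
      refine Or.inr ⟨(hS _).2 ⟨h1, fun i hi => h2 i (Finset.mem_of_mem_erase hi)⟩,
        (hS _).2 ⟨fun i => ?_, fun i hi => ?_⟩⟩
      · by_cases hik : i = k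
        · subst hik
          have := h1 i
          have := h2 i hk
          simp only [Function.update_self]
          omega
        · simpa [hik] using h1 i
      · obtain ⟨hik, hi⟩ := Finset.mem_erase.1 hi
        simpa [hik] using h2 i hi)
  refine ⟨C ∪ ⋃ c ∈ S, (ψ ∘ A) '' latticeFace c, W, ?_, hW, hCW, union_subset_union_right C ?_,
    hred⟩
  · exact hC.union (S.finite_toSet.isClosed_biUnion fun c' _ =>
      ((isCompact_cubeFace _ _).image hψA.continuous).isClosed)
  · rintro _ ⟨x, hx, rfl⟩
    obtain ⟨y, rfl⟩ := A.surjective x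
    have hy : ∀ i, |y i| < N := by
      have : ‖(N : ℝ)⁻¹ • y‖ < 1 := mem_ball_zero_iff.1 hx
      rw [norm_smul, norm_inv, Real.norm_of_nonneg hN.le, inv_mul_lt_one₀ hN] at this
      exact fun i => (norm_le_pi_norm y i).trans_lt this
    simp only [mem_iUnion₂]
    refine ⟨(fun i => ⌊y i⌋, Finset.univ), (hS _).2 ⟨fun i => ?_, fun i _ => ?_⟩, y,
      mem_latticeFace.2 ⟨fun i _ => ⟨Int.floor_le _, (Int.lt_floor_add_one _).le⟩,
        fun j hj => absurd (Finset.mem_univ j) hj⟩, rfl⟩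
    · have := abs_lt.1 (hy i)
      refine ⟨Int.le_floor.2 (by push_cast; linarith), ?_⟩
      exact (Int.floor_lt.2 (by push_cast; linarith)).le
    · have := abs_lt.1 (hy i)
      exact Int.add_one_le_iff.2 (Int.floor_lt.2 (by push_cast; linarith))

end Absorbable

lemma exists_isOpenEmbedding_of_locallyEuclidean {M : Type*} [TopologicalSpace M]
    (hM : LocallyEuclidean M) (x : M) :
    ∃ (n : ℕ) (ψ : (Fin n → ℝ) → M), IsOpenEmbedding ψ ∧ ψ 0 = x := by
  obtain ⟨n, U, V, hU, hxU, hV, ⟨e⟩⟩ := hM x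
  obtain ⟨r, hr, hrV⟩ := Metric.isOpen_iff.1 hV (e ⟨x, hxU⟩) (e ⟨x, hxU⟩).2
  let u := OpenPartialHomeomorph.univBall (e ⟨x, hxU⟩ : EuclideanSpace ℝ (Fin n)) r
  let w := (PiLp.homeomorph 2 fun _ : Fin n => ℝ).symm
  have huw : IsOpenEmbedding (u ∘ w) :=
    (u.isOpenEmbedding (OpenPartialHomeomorph.univBall_source _ _)).comp w.isOpenEmbedding
  have hmem : ∀ y, u (w y) ∈ V := fun y => hrV <| by
    rw [← OpenPartialHomeomorph.univBall_target _ hr]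
    exact u.map_source (by simp [u])
  let β : (Fin n → ℝ) → V := fun y => ⟨u (w y), hmem y⟩
  have hβ : IsOpenEmbedding β := IsOpenEmbedding.of_comp β hV.isOpenEmbedding_subtypeVal huw
  refine ⟨n, Subtype.val ∘ e.symm ∘ β,
    hU.isOpenEmbedding_subtypeVal.comp (e.symm.isOpenEmbedding.comp hβ), ?_⟩
  have hw : w 0 = 0 := rfl
  have h0 : β 0 = e ⟨x, hxU⟩ := Subtype.ext (by
    change u (w 0) = _
    rw [hw]
    exact OpenPartialHomeomorph.univBall_apply_zero _ _)
  simp [h0]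

lemma absorbable_univ {M : Type*} [MetricSpace M] [CompactSpace M] (hM : LocallyEuclidean M) :
    Absorbable (univ : Set M) := by
  refine isCompact_univ.induction_on absorbable_empty (fun s t hst ht => ht.mono hst)
    (fun s t hs ht => hs.union ht) fun x _ => ?_
  obtain ⟨n, ψ, hψ, rfl⟩ := exists_isOpenEmbedding_of_locallyEuclidean hM x
  exact ⟨ψ '' ball 0 1, mem_nhdsWithin_of_mem_nhds
    ((hψ.isOpenMap _ isOpen_ball).mem_nhds ⟨0, mem_ball_self one_pos, rfl⟩),
    absorbable_image_ball hψ⟩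

end HomeoIsotopy

/-- **Corollary (of the Chernavskii–Edwards–Kirby local contractibility theorem).**
Let `M` be a compact metrizable topological manifold without boundary, equipped with a
metric `ρ`.  Then there exists `ε > 0` such that every homeomorphism `h : M → M` with
`sup_x ρ(h x, x) < ε` is isotopic to the identity: there is a continuous
`H : M × [0,1] → M` with `H (·, 0) = h`, `H (·, 1) = 1_M` and `H (·, t)` a
homeomorphism for every `t`. -/
theorem small_homeomorphism_isotopic_to_id (M : Type*) [MetricSpace M] [CompactSpace M]
    (hM : LocallyEuclidean M) :
    ∃ ε : ℝ, 0 < ε ∧ ∀ h : M ≃ₜ M, (∀ x : M, dist (h x) x < ε) →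
      ∃ H : C(M × I, M),
        (∀ x : M, H (x, 0) = h x) ∧
        (∀ x : M, H (x, 1) = x) ∧
        (∀ t : I, ∃ e : M ≃ₜ M, ∀ x : M, H (x, t) = e x) := by
  obtain ⟨D, W, -, -, hDW, hD, hred⟩ := HomeoIsotopy.absorbable_univ hM ∅ ∅ isClosed_empty
    isOpen_empty (Set.Subset.refl _)
  obtain ⟨ε, hε, H⟩ := hred 1 one_pos
  refine ⟨ε, hε, fun h hh => ?_⟩
  obtain ⟨h', -, hW, hi⟩ := H h hh (by simp)
  exact hi (HomeoIsotopy.isotopicToId_of_forall_eq fun x => hW x (hDW (hD (by simp))))
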